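/- Local Kronecker–Weber theorem: let p be a prime and F/Q_p a finite abelian Galois extension (inside a fixed algebraic closure of Q_p) of degree p^n · m with gcd(p, m) = 1. Then F is contained in the cyclotomic extension Q_p(ζ_{p^{n+2}}, ζ_{p^{p^n · m}−1}). -/

import Mathlib

open Polynomial
namespace KW

/-- The algebraic closure of the p-adic numbers. -/
abbrev Om (p : ℕ) [Fact p.Prime] := AlgebraicClosure ℚ_[p]
/-- The absolute Galois group. -/
abbrev GG (p : ℕ) [Fact p.Prime] := Om p ≃ₐ[ℚ_[p]] Om p

variable {p : ℕ} [hp : Fact p.Prime]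

lemma norm_map (σ : GG p) (x : Om p) : ‖σ x‖ = ‖x‖ :=
  (spectralNorm_eq_of_equiv (K := ℚ_[p]) σ x).symm

lemma norm_intCast (n : ℤ) : ‖(n : Om p)‖ = ‖(n : ℚ_[p])‖ := by
  rw [← PadicAlgCl.norm_extends p (n : ℚ_[p])]
  simp

lemma norm_natCast (n : ℕ) : ‖(n : Om p)‖ = ‖(n : ℚ_[p])‖ := by
  rw [← PadicAlgCl.norm_extends p (n : ℚ_[p])]
  simp

lemma norm_p_lt : ‖(p : Om p)‖ < 1 := by
  rw [norm_natCast, Padic.norm_natCast_lt_one_iff]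

lemma norm_p_pos : 0 < ‖(p : Om p)‖ := by
  rw [norm_pos_iff]; exact_mod_cast hp.1.ne_zero

lemma norm_intCast_lt (n : ℤ) : ‖(n : Om p)‖ < 1 ↔ (p : ℤ) ∣ n := by
  rw [norm_intCast, Padic.norm_intCast_lt_one_iff]

lemma norm_natCast_lt (n : ℕ) : ‖(n : Om p)‖ < 1 ↔ p ∣ n := by
  rw [norm_natCast, Padic.norm_natCast_lt_one_iff]

lemma norm_natCast_le (n : ℕ) : ‖(n : Om p)‖ ≤ 1 := IsUltrametricDist.norm_natCast_le_one _ n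

lemma norm_natCast_eq {n : ℕ} (h : n.Coprime p) : ‖(n : Om p)‖ = 1 := by
  refine le_antisymm (norm_natCast_le n) (not_lt.1 fun h' => ?_)
  rw [norm_natCast_lt] at h'
  exact hp.1.one_lt.ne' (Nat.dvd_one.1 (h ▸ Nat.dvd_gcd h' dvd_rfl))

lemma norm_add_le' {x y : Om p} {r : ℝ} (hx : ‖x‖ ≤ r) (hy : ‖y‖ ≤ r) : ‖x + y‖ ≤ r :=
  (IsUltrametricDist.norm_add_le_max x y).trans (max_le hx hy)
lemma norm_add_lt' {x y : Om p} {r : ℝ} (hx : ‖x‖ < r) (hy : ‖y‖ < r) : ‖x + y‖ < r :=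
  (IsUltrametricDist.norm_add_le_max x y).trans_lt (max_lt hx hy)
lemma norm_sub_le' {x y : Om p} {r : ℝ} (hx : ‖x‖ ≤ r) (hy : ‖y‖ ≤ r) : ‖x - y‖ ≤ r := by
  rw [sub_eq_add_neg]; exact norm_add_le' hx (by rwa [norm_neg])
lemma norm_sub_lt' {x y : Om p} {r : ℝ} (hx : ‖x‖ < r) (hy : ‖y‖ < r) : ‖x - y‖ < r := by
  rw [sub_eq_add_neg]; exact norm_add_lt' hx (by rwa [norm_neg])

/-- The valuation ring. -/
noncomputable abbrev OO (p : ℕ) [Fact p.Prime] : ValuationSubring (Om p) :=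
  (NormedField.valuation (K := Om p)).valuationSubring

lemma mem_OO {x : Om p} : x ∈ OO p ↔ ‖x‖ ≤ 1 := by
  rw [Valuation.mem_valuationSubring_iff, NormedField.valuation_apply]
  exact_mod_cast Iff.rfl

/-- The residue field. -/
noncomputable abbrev kk (p : ℕ) [Fact p.Prime] := IsLocalRing.ResidueField (OO p)

/-- Reduction. -/
noncomputable abbrev red : OO p →+* kk p := IsLocalRing.residue (OO p)

lemma red_eq_zero {x : OO p} : red x = 0 ↔ ‖(x : Om p)‖ < 1 := by
  rw [IsLocalRing.residue_eq_zero_iff, Valuation.mem_maximalIdeal_iff, NormedField.valuation_apply]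
  exact_mod_cast Iff.rfl

lemma red_eq {x y : OO p} : red x = red y ↔ ‖(x - y : Om p)‖ < 1 := by
  rw [← sub_eq_zero, ← map_sub, red_eq_zero]; simp

instance : CharP (kk p) p := by
  refine (CharP.charP_iff_prime_eq_zero hp.1).2 ?_
  have : red ((p : ℕ) : OO p) = 0 := by
    rw [red_eq_zero]; simpa using norm_p_lt
  simpa using this

noncomputable instance : Algebra (ZMod p) (kk p) := ZMod.algebra _ p

/-- Integers into the valuation ring. -/
noncomputable def ι : ℤ_[p] →+* OO p :=
  ((algebraMap ℚ_[p] (Om p)).comp PadicInt.Coe.ringHom).codRestrict (OO p).toSubring (by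
    intro x
    change _ ∈ OO p
    rw [mem_OO]
    change ‖algebraMap ℚ_[p] (Om p) (x : ℚ_[p])‖ ≤ 1
    rw [PadicAlgCl.norm_extends p]
    exact x.2)

lemma ι_coe (x : ℤ_[p]) : ((ι x : OO p) : Om p) = algebraMap ℚ_[p] (Om p) (x : ℚ_[p]) := rfl

lemma red_ι : (red (p := p)).comp ι = (algebraMap (ZMod p) (kk p)).comp PadicInt.toZMod := by
  ext x
  have h := PadicInt.toZMod_spec x
  set n := (PadicInt.toZMod x) with hn
  have h1 : algebraMap (ZMod p) (kk p) n = red (ι ((n.val : ℕ) : ℤ_[p])) := by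
    conv_lhs => rw [← ZMod.natCast_zmod_val n]
    rw [map_natCast, map_natCast, map_natCast]
  simp only [RingHom.comp_apply]
  rw [← hn, h1, red_eq]
  rw [IsLocalRing.mem_maximalIdeal, PadicInt.mem_nonunits] at h
  rw [ι_coe, ι_coe, ← map_sub, PadicAlgCl.norm_extends p]
  have : (n.cast : ℤ_[p]) = (n.val : ℕ) := by simp
  rw [this] at h
  exact_mod_cast h

lemma isIntegral_of_norm_le {t : Om p} (ht : ‖t‖ ≤ 1) : IsIntegral ℤ_[p] t := by
  have hm := minpoly.monic (Algebra.IsIntegral.isIntegral (R := ℚ_[p]) t)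
  have h := (spectralValue_le_one_iff hm).1 ht
  have hl : minpoly ℚ_[p] t ∈ lifts (algebraMap ℤ_[p] ℚ_[p]) := by
    rw [lifts_iff_coeff_lifts]
    intro n
    exact ⟨⟨_, h n⟩, rfl⟩
  obtain ⟨Q, hQ, -, hQm⟩ := lifts_and_natDegree_eq_and_monic hl hm
  refine ⟨Q, hQm, ?_⟩
  have := minpoly.aeval ℚ_[p] t
  rw [← hQ, aeval_map_algebraMap] at this
  exact this

/-- evaluation of reductions -/
lemma eval_red (Q : ℤ_[p][X]) (x : OO p) :
    red (Q.eval₂ ι x) = (Q.map PadicInt.toZMod).eval₂ (algebraMap (ZMod p) (kk p)) (red x) := by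
  rw [hom_eval₂, red_ι, eval₂_map]

lemma eval_coe (Q : ℤ_[p][X]) (x : OO p) :
    ((Q.eval₂ ι x : OO p) : Om p) = aeval (x : Om p) Q := by
  change (OO p).subtype _ = _
  rw [hom_eval₂]; rfl

lemma isAlgebraic_red (x : OO p) : IsIntegral (ZMod p) (red x) := by
  obtain ⟨Q, hQ, h⟩ := isIntegral_of_norm_le (mem_OO.1 x.2)
  refine ⟨Q.map PadicInt.toZMod, hQ.map _, ?_⟩
  rw [← eval_red]
  have : (Q.eval₂ ι x : OO p) = 0 := by
    apply Subtype.ext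
    rw [eval_coe]; exact h
  rw [this, map_zero]

lemma exists_pow_red (x : OO p) : red x = 0 ∨ ∃ f : ℕ, 0 < f ∧ (red x) ^ (p ^ f - 1) = 1 := by
  have h := isAlgebraic_red x
  have : FiniteDimensional (ZMod p) (IntermediateField.adjoin (ZMod p) {red x}) :=
    IntermediateField.adjoin.finiteDimensional h
  have : Finite (IntermediateField.adjoin (ZMod p) {red x}) := Module.finite_of_finite (ZMod p)
  have := Fintype.ofFinite (IntermediateField.adjoin (ZMod p) {red x})
  by_cases h0 : red x = 0
  · exact Or.inl h0
  right
  refine ⟨Module.finrank (ZMod p) (IntermediateField.adjoin (ZMod p) {red x}), Module.finrank_pos, ?_⟩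
  have h1 := FiniteField.pow_card_sub_one_eq_one
    (⟨red x, IntermediateField.mem_adjoin_simple_self _ _⟩ : IntermediateField.adjoin (ZMod p) {red x})
    (by simpa [Subtype.ext_iff] using h0)
  rw [Module.card_eq_pow_finrank (K := ZMod p) (V := IntermediateField.adjoin (ZMod p) {red x}), ZMod.card] at h1
  simpa [Subtype.ext_iff] using h1

lemma coprime_sub {f : ℕ} (hf : 0 < f) : (p ^ f - 1).Coprime p := by
  have h2 : 0 < p ^ f := pow_pos hp.1.pos f
  rw [Nat.coprime_comm, Nat.Prime.coprime_iff_not_dvd hp.1]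
  intro h
  have h3 : p ∣ p ^ f := dvd_pow_self p hf.ne'
  have := (Nat.dvd_sub h3 h)
  rw [Nat.sub_sub_self h2] at this
  exact hp.1.one_lt.ne' (Nat.dvd_one.1 this)

lemma norm_root {z : Om p} {N : ℕ} (hN : N ≠ 0) (h : z ^ N = 1) : ‖z‖ = 1 := by
  have : ‖z‖ ^ N = 1 := by rw [← norm_pow, h, norm_one]
  exact (pow_eq_one_iff_of_nonneg (norm_nonneg _) hN).1 this

lemma pow_sub_one_prod {ζ : Om p} {N : ℕ} (hN : 0 < N) (hζ : IsPrimitiveRoot ζ N) (x : Om p) :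
    x ^ N - 1 = ∏ ξ ∈ nthRootsFinset N (1 : Om p), (x - ξ) := by
  have := congrArg (eval x) (X_pow_sub_one_eq_prod hN hζ)
  simpa [eval_prod] using this

lemma exists_lt_of_prod_lt {ι : Type*} {s : Finset ι} {f : ι → Om p} (h : ‖∏ i ∈ s, f i‖ < 1) :
    ∃ i ∈ s, ‖f i‖ < 1 := by
  by_contra! h'
  rw [norm_prod] at h
  refine absurd h (not_lt.2 ?_)
  calc (1 : ℝ) = ∏ i ∈ s, (1 : ℝ) := by simp
    _ ≤ _ := Finset.prod_le_prod (fun _ _ => zero_le_one) h'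

lemma exists_prim (N : ℕ) (hN : 0 < N) : ∃ ζ : Om p, IsPrimitiveRoot ζ N := by
  have : NeZero (N : Om p) := ⟨by exact_mod_cast hN.ne'⟩
  exact HasEnoughRootsOfUnity.exists_primitiveRoot _ N

/-- Every integral element is congruent to zero or to a root of unity of order prime to p. -/
lemma exists_teich {t : Om p} (ht : ‖t‖ = 1) :
    ∃ c : Om p, ∃ N : ℕ, 0 < N ∧ N.Coprime p ∧ c ^ N = 1 ∧ ‖t - c‖ < 1 := by
  rcases exists_pow_red ⟨t, mem_OO.2 ht.le⟩ with h | ⟨f, hf, h⟩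
  · rw [red_eq_zero] at h
    exact absurd ht h.ne
  have hN : 0 < p ^ f - 1 := by
    have := Nat.one_lt_pow hf.ne' hp.1.one_lt
    omega
  obtain ⟨ζ, hζ⟩ := exists_prim (p := p) (p ^ f - 1) hN
  rw [← map_pow, ← map_one red, red_eq] at h
  simp only [SubmonoidClass.coe_pow, OneMemClass.coe_one] at h
  rw [pow_sub_one_prod hN hζ] at h
  obtain ⟨c, hc, h⟩ := exists_lt_of_prod_lt h
  rw [mem_nthRootsFinset hN] at hc
  exact ⟨c, _, hN, coprime_sub hf, hc, h⟩

lemma root_eq_one {ξ : Om p} {N : ℕ} (hN : N.Coprime p) (h : ξ ^ N = 1) (hl : ‖ξ - 1‖ < 1) : ξ = 1 := by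
  by_contra hne
  have h0 : ∑ i ∈ Finset.range N, ξ ^ i = 0 := by
    have := geom_sum_mul ξ N
    rw [h, sub_self] at this
    exact (mul_eq_zero.1 this).resolve_right (sub_ne_zero.2 hne)
  have hN0 : N ≠ 0 := by
    rintro rfl
    simp at hN
    exact hp.1.one_lt.ne' hN
  have hξ := norm_root hN0 h
  have h1 : ‖∑ i ∈ Finset.range N, (ξ ^ i - 1)‖ < 1 := by
    refine (IsUltrametricDist.norm_sum_le_of_forall_le_of_nonneg (norm_nonneg (ξ - 1)) ?_).trans_lt hl
    intro i _
    rw [← geom_sum_mul, norm_mul]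
    refine mul_le_of_le_one_left (norm_nonneg _) ?_
    refine IsUltrametricDist.norm_sum_le_of_forall_le_of_nonneg zero_le_one ?_
    intro j _
    rw [norm_pow, hξ, one_pow]
  rw [Finset.sum_sub_distrib, h0] at h1
  simp only [Finset.sum_const, Finset.card_range, nsmul_eq_mul, mul_one, zero_sub, norm_neg] at h1
  rw [norm_natCast_eq hN] at h1
  exact lt_irrefl _ h1

lemma root_eq {z w : Om p} {N : ℕ} (hN : N.Coprime p) (hz : z ^ N = 1) (hw : w ^ N = 1)
    (h : ‖z - w‖ < 1) : z = w := by
  have hN0 : N ≠ 0 := by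
    rintro rfl
    simp at hN
    exact hp.1.one_lt.ne' hN
  have hw0 : ‖w‖ = 1 := norm_root hN0 hw
  have hw1 : w ≠ 0 := norm_ne_zero_iff.1 (by rw [hw0]; exact one_ne_zero)
  have : z / w = 1 := by
    refine root_eq_one hN (by rw [div_pow, hz, hw, div_one]) ?_
    rw [div_sub_one hw1, norm_div, hw0, div_one]
    exact h
  exact (div_eq_one_iff_eq hw1).1 this

/-- The action of the Galois group on the residue field. -/
lemma exists_bar (σ : GG p) : ∃ τ : kk p →+* kk p, ∀ x : OO p, ∀ y : OO p,
    (y : Om p) = σ x → red y = τ (red x) := by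
  let s : OO p →+* OO p := ((σ : Om p →+* Om p).comp (OO p).subtype).codRestrict (OO p).toSubring (by
    intro x
    change _ ∈ OO p
    rw [mem_OO]
    change ‖σ x‖ ≤ 1
    rw [norm_map]; exact mem_OO.1 x.2)
  have hs : ∀ x, ((s x : OO p) : Om p) = σ x := fun _ => rfl
  let t : kk p →+* kk p := Ideal.Quotient.lift _ (red.comp s) (by
    intro a ha
    have : red a = 0 := (IsLocalRing.residue_eq_zero_iff a).2 ha
    rw [red_eq_zero] at this
    rw [RingHom.comp_apply, red_eq_zero, hs, norm_map]
    exact this)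
  refine ⟨t, fun x y h => ?_⟩
  have : y = s x := Subtype.ext h
  rw [this]
  rfl

lemma mem_range_of_pow {c : kk p} (hc : c ^ p = c) : c ∈ (algebraMap (ZMod p) (kk p)).range := by
  classical
  by_contra hcon
  let P : (kk p)[X] := X ^ p - X
  have hP : P ≠ 0 := FiniteField.X_pow_card_sub_X_ne_zero _ hp.1.one_lt
  have hdeg : P.natDegree = p := FiniteField.X_pow_card_sub_X_natDegree_eq _ hp.1.one_lt
  let S : Finset (kk p) := insert c (Finset.univ.image (algebraMap (ZMod p) (kk p)))
  have hS : S.card = p + 1 := by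
    rw [Finset.card_insert_of_notMem, Finset.card_image_of_injective _ (algebraMap (ZMod p) (kk p)).injective]
    · simp
    · simpa using hcon
  have hroots : ∀ x ∈ S, P.eval x = 0 := by
    intro x hx
    rcases Finset.mem_insert.1 hx with rfl | hx
    · simp [P, hc]
    · obtain ⟨a, -, rfl⟩ := Finset.mem_image.1 hx
      simp only [P, eval_sub, eval_pow, eval_X]
      rw [← map_pow, ZMod.pow_card, sub_self]
  exact hP (eq_zero_of_natDegree_lt_card_of_eval_eq_zero' P S hroots (by omega))

end KW

open Polynomial
namespace KW
variable {p : ℕ} [hp : Fact p.Prime]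

lemma ne_zero_of_coprime {N : ℕ} (hN : N.Coprime p) : N ≠ 0 := by
  rintro rfl
  simp at hN
  exact hp.1.one_lt.ne' hN

/-- Automorphisms fixing all roots of unity of order prime to p. -/
noncomputable def II (p : ℕ) [Fact p.Prime] : Subgroup (GG p) :=
  fixingSubgroup (GG p) {z : Om p | ∃ N : ℕ, N.Coprime p ∧ z ^ N = 1}

lemma mem_II {σ : GG p} : σ ∈ II p ↔ ∀ (N : ℕ) (z : Om p), N.Coprime p → z ^ N = 1 → σ z = z := by
  rw [II, mem_fixingSubgroup_iff]
  constructor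
  · intro h N z hN hz
    exact h z ⟨N, hN, hz⟩
  · rintro h z ⟨N, hN, hz⟩
    exact h N z hN hz

/-- The automorphisms in `II` fixing `z`. -/
noncomputable def JJ (z : Om p) : Subgroup (GG p) := II p ⊓ MulAction.stabilizer (GG p) z

lemma mem_JJ {z : Om p} {σ : GG p} : σ ∈ JJ z ↔ σ ∈ II p ∧ σ z = z := by
  rw [JJ, Subgroup.mem_inf, MulAction.mem_stabilizer_iff]; rfl

lemma mem_adjoin_of_fixed (S : Set (Om p)) (x : Om p)
    (h : ∀ σ : GG p, (∀ s ∈ S, σ s = s) → σ x = x) : x ∈ IntermediateField.adjoin ℚ_[p] S := by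
  rw [← InfiniteGalois.fixedField_fixingSubgroup (IntermediateField.adjoin ℚ_[p] S)]
  rw [IntermediateField.mem_fixedField_iff]
  intro σ hσ
  refine h σ fun s hs => ?_
  rw [IntermediateField.mem_fixingSubgroup_iff] at hσ
  exact hσ s (IntermediateField.subset_adjoin _ _ hs)

lemma mem_bot_of_fixed (x : Om p) (h : ∀ σ : GG p, σ x = x) : ∃ a : ℚ_[p], algebraMap ℚ_[p] (Om p) a = x := by
  have := mem_adjoin_of_fixed (p := p) ∅ x fun σ _ => h σ
  rw [IntermediateField.adjoin_empty] at this
  exact this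

lemma smooth {z x : Om p} (h : ∀ σ ∈ JJ z, σ x = x) :
    ∃ N : ℕ, N.Coprime p ∧ ∀ σ : GG p, σ z = z → (∀ w, w ^ N = 1 → σ w = w) → σ x = x := by
  have hx := mem_adjoin_of_fixed ({w : Om p | ∃ N : ℕ, N.Coprime p ∧ w ^ N = 1} ∪ {z}) x (by
    intro σ hσ
    refine h σ (mem_JJ.2 ⟨mem_II.2 fun N w hN hw => hσ w (Or.inl ⟨N, hN, hw⟩), hσ z (Or.inr rfl)⟩))
  clear h
  induction hx using IntermediateField.adjoin_induction with
  | mem y hy =>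
    rcases hy with ⟨N, hN, hy⟩ | hy
    · exact ⟨N, hN, fun σ _ h2 => h2 y hy⟩
    · rw [Set.mem_singleton_iff] at hy
      subst hy
      exact ⟨1, Nat.coprime_one_left p, fun σ h1 _ => h1⟩
  | algebraMap y => exact ⟨1, Nat.coprime_one_left p, fun σ _ _ => σ.commutes y⟩
  | add a b ha hb h1 h2 =>
    obtain ⟨N, hN, h1⟩ := h1
    obtain ⟨M, hM, h2⟩ := h2
    refine ⟨N * M, Nat.Coprime.mul_left hN hM, fun σ hz hw => ?_⟩
    rw [map_add, h1 σ hz fun w h => hw w (by rw [pow_mul, h, one_pow]),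
      h2 σ hz fun w h => hw w (by rw [mul_comm, pow_mul, h, one_pow])]
  | inv a ha h1 =>
    obtain ⟨N, hN, h1⟩ := h1
    exact ⟨N, hN, fun σ hz hw => by rw [map_inv₀, h1 σ hz hw]⟩
  | mul a b ha hb h1 h2 =>
    obtain ⟨N, hN, h1⟩ := h1
    obtain ⟨M, hM, h2⟩ := h2
    refine ⟨N * M, Nat.Coprime.mul_left hN hM, fun σ hz hw => ?_⟩
    rw [map_mul, h1 σ hz fun w h => hw w (by rw [pow_mul, h, one_pow]),
      h2 σ hz fun w h => hw w (by rw [mul_comm, pow_mul, h, one_pow])]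

/-- Every automorphism acts on roots of unity of order `N` prime to `p` as a power of Frobenius. -/
lemma exists_frob_pow (σ : GG p) {N : ℕ} (hN : N.Coprime p) :
    ∃ j : ℕ, ∀ z : Om p, z ^ N = 1 → σ z = z ^ (p ^ j) := by
  have hN0 := ne_zero_of_coprime hN
  obtain ⟨ζ, hζ⟩ := exists_prim (p := p) N (Nat.pos_of_ne_zero hN0)
  have : NeZero N := ⟨hN0⟩
  suffices h : ∃ j : ℕ, σ ζ = ζ ^ (p ^ j) by
    obtain ⟨j, hj⟩ := h
    refine ⟨j, fun z hz => ?_⟩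
    obtain ⟨i, -, rfl⟩ := hζ.eq_pow_of_pow_eq_one hz
    rw [map_pow, hj, ← pow_mul, ← pow_mul, mul_comm]
  have hmem : ∀ z : Om p, z ^ N = 1 → z ∈ OO p := fun z hz => mem_OO.2 (norm_root hN0 hz).le
  have hσζ : (σ ζ) ^ N = 1 := by rw [← map_pow, hζ.pow_eq_one, map_one]
  let x : kk p := red ⟨ζ, hmem ζ hζ.pow_eq_one⟩
  obtain ⟨τ, hτ⟩ := exists_bar σ
  have hy := hτ ⟨ζ, hmem ζ hζ.pow_eq_one⟩ ⟨σ ζ, hmem _ hσζ⟩ rfl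
  change _ = τ x at hy
  have hxN : x ^ N = 1 := by
    rw [← map_pow, ← map_one red]
    congr 1
    exact Subtype.ext hζ.pow_eq_one
  obtain ⟨f, hf, hxf⟩ : ∃ f : ℕ, 0 < f ∧ x ^ (p ^ f) = x := by
    refine ⟨N.totient, Nat.totient_pos.2 (Nat.pos_of_ne_zero hN0), ?_⟩
    have h1 : p ^ N.totient ≡ 1 [MOD N] := Nat.ModEq.pow_totient hN.symm
    have : x ^ (p ^ N.totient) = x ^ 1 := by
      rw [pow_eq_pow_mod _ hxN, h1, ← pow_eq_pow_mod _ hxN]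
    rwa [pow_one] at this
  let P : (kk p)[X] := ∏ j ∈ Finset.range f, (X - C (x ^ (p ^ j)))
  have hP : P.map (frobenius (kk p) p) = P := by
    simp only [P, Polynomial.map_prod, Polynomial.map_sub, map_X, map_C, frobenius_def]
    obtain ⟨e, rfl⟩ : ∃ e, f = e + 1 := ⟨f - 1, by omega⟩
    rw [Finset.prod_range_succ, Finset.prod_range_succ']
    congr 1
    · refine Finset.prod_congr rfl fun j _ => ?_
      rw [← pow_mul, ← pow_succ]
    · rw [← pow_mul, ← pow_succ, hxf, pow_zero, pow_one]
  have hl : P ∈ lifts (algebraMap (ZMod p) (kk p)) := by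
    rw [lifts_iff_coeff_lifts]
    intro n
    refine mem_range_of_pow ?_
    conv_rhs => rw [← hP]
    rw [coeff_map, frobenius_def]
  obtain ⟨Q, hQ⟩ := hl
  have hQ : Q.map (algebraMap (ZMod p) (kk p)) = P := hQ
  have h0 : Q.eval₂ (algebraMap (ZMod p) (kk p)) x = 0 := by
    rw [← eval_map, hQ]
    simp only [P, eval_prod]
    refine Finset.prod_eq_zero (Finset.mem_range.2 hf) ?_
    simp
  have h1 : Q.eval₂ (algebraMap (ZMod p) (kk p)) (τ x) = 0 := by
    have := congrArg τ h0
    rw [hom_eval₂, map_zero] at this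
    rwa [Subsingleton.elim (τ.comp (algebraMap (ZMod p) (kk p))) (algebraMap (ZMod p) (kk p))] at this
  rw [← eval_map, hQ] at h1
  simp only [P, eval_prod, Finset.prod_eq_zero_iff] at h1
  obtain ⟨j, -, hj⟩ := h1
  simp only [eval_sub, eval_X, eval_C, sub_eq_zero] at hj
  refine ⟨j, root_eq hN hσζ (by rw [← pow_mul, mul_comm, pow_mul, hζ.pow_eq_one, one_pow]) ?_⟩
  rw [← hy, ← map_pow, red_eq] at hj
  exact hj

lemma exists_lt_of_mprod_lt {ι : Type*} {s : Multiset ι} {f : ι → Om p} (h : ‖(s.map f).prod‖ < 1) :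
    ∃ i ∈ s, ‖f i‖ < 1 := by
  induction s using Multiset.induction with
  | empty => simp at h
  | cons a s ih =>
    rw [Multiset.map_cons, Multiset.prod_cons, norm_mul] at h
    by_cases h1 : ‖f a‖ < 1
    · exact ⟨a, by simp, h1⟩
    · obtain ⟨i, hi, h2⟩ := ih (by
        push Not at h1
        by_contra h3
        push Not at h3
        nlinarith)
      exact ⟨i, by simp [hi], h2⟩

lemma exists_frob_aux {N : ℕ} (hN : N.Coprime p) :
    ∃ σ : GG p, ∀ z : Om p, z ^ N = 1 → σ z = z ^ p := by
  have hN0 := ne_zero_of_coprime hN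
  obtain ⟨ζ, hζ⟩ := exists_prim (p := p) N (Nat.pos_of_ne_zero hN0)
  have : NeZero N := ⟨hN0⟩
  suffices h : ∃ σ : GG p, σ ζ = ζ ^ p by
    obtain ⟨σ, hj⟩ := h
    refine ⟨σ, fun z hz => ?_⟩
    obtain ⟨i, -, rfl⟩ := hζ.eq_pow_of_pow_eq_one hz
    rw [map_pow, hj, ← pow_mul, ← pow_mul, mul_comm]
  have hn : ‖ζ‖ ≤ 1 := (norm_root hN0 hζ.pow_eq_one).le
  have hxint := isIntegral_of_norm_le hn
  let x : OO p := ⟨ζ, mem_OO.2 hn⟩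
  let g := minpoly ℤ_[p] ζ
  have hg : g.map (algebraMap ℤ_[p] ℚ_[p]) = minpoly ℚ_[p] ζ :=
    (minpoly.isIntegrallyClosed_eq_field_fractions' ℚ_[p] hxint).symm
  have h0 : (g.map PadicInt.toZMod).eval₂ (algebraMap (ZMod p) (kk p)) (red x) = 0 := by
    rw [← eval_red]
    have : (g.eval₂ ι x : OO p) = 0 := by
      apply Subtype.ext
      rw [eval_coe]; exact minpoly.aeval _ _
    rw [this, map_zero]
  have h1 : (g.map PadicInt.toZMod).eval₂ (algebraMap (ZMod p) (kk p)) (red (x ^ p)) = 0 := by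
    have := congrArg (frobenius (kk p) p) h0
    rw [hom_eval₂, map_zero, frobenius_def] at this
    rwa [Subsingleton.elim ((frobenius (kk p) p).comp (algebraMap (ZMod p) (kk p)))
      (algebraMap (ZMod p) (kk p)), ← map_pow] at this
  rw [← eval_red, red_eq_zero, eval_coe] at h1
  have h2 : aeval (ζ ^ p) g = aeval (ζ ^ p) (minpoly ℚ_[p] ζ) := by
    rw [← hg, aeval_map_algebraMap]
  have h3 : ‖aeval (ζ ^ p) (minpoly ℚ_[p] ζ)‖ < 1 := by rw [← h2]; exact h1
  have hi : IsIntegral ℚ_[p] ζ := Algebra.IsIntegral.isIntegral ζ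
  have hs : ((minpoly ℚ_[p] ζ).map (algebraMap ℚ_[p] (Om p))).Splits := IsAlgClosed.splits _
  have h4 : aeval (ζ ^ p) (minpoly ℚ_[p] ζ) =
      (((minpoly ℚ_[p] ζ).map (algebraMap ℚ_[p] (Om p))).roots.map (fun r => ζ ^ p - r)).prod := by
    rw [aeval_def, ← eval_map]
    conv_lhs => rw [hs.eq_prod_roots_of_monic ((minpoly.monic hi).map _)]
    rw [eval_multiset_prod, Multiset.map_map]
    simp
  rw [h4] at h3
  have h5 : ∃ r ∈ ((minpoly ℚ_[p] ζ).map (algebraMap ℚ_[p] (Om p))).roots, ‖ζ ^ p - r‖ < 1 := exists_lt_of_mprod_lt h3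
  obtain ⟨r, hr, hlt⟩ := h5
  have hr' : aeval r (minpoly ℚ_[p] ζ) = 0 := by
    rw [mem_roots', IsRoot.def, eval_map] at hr
    exact hr.2
  have hc : IsConjRoot ℚ_[p] ζ r := by
    rw [isConjRoot_iff_aeval_eq_zero hi]; exact hr'
  rw [isConjRoot_iff_exists_algEquiv] at hc
  obtain ⟨σ, hσ⟩ := hc
  have hσ' : σ.symm ζ = r := by rw [← hσ]; simp
  have hrN : r ^ N = 1 := by rw [← hσ', ← map_pow, hζ.pow_eq_one, map_one]
  refine ⟨σ.symm, ?_⟩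
  rw [hσ']
  exact (root_eq hN (by rw [← pow_mul, mul_comm, pow_mul, hζ.pow_eq_one, one_pow]) hrN hlt).symm

lemma isClosed_map_eq (z w : Om p) : IsClosed {σ : GG p | σ z = w} := by
  by_cases h : ∃ σ₀ : GG p, σ₀ z = w
  · obtain ⟨σ₀, h⟩ := h
    have h1 : IsClosed (MulAction.stabilizer (GG p) z : Set (GG p)) :=
      Subgroup.isClosed_of_isOpen _ (stabilizer_isOpen_of_isIntegral z)
    have h2 : {σ : GG p | σ z = w} = (fun σ => σ₀⁻¹ * σ) ⁻¹' (MulAction.stabilizer (GG p) z : Set (GG p)) := by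
      ext σ
      simp only [Set.mem_setOf_eq, Set.mem_preimage, SetLike.mem_coe, MulAction.mem_stabilizer_iff]
      rw [mul_smul, inv_smul_eq_iff, AlgEquiv.smul_def, AlgEquiv.smul_def, h]
    rw [h2]
    exact h1.preimage (continuous_const_mul _)
  · push Not at h
    convert isClosed_empty
    ext σ
    simp [h σ]

/-- Frobenius on all roots of unity of order prime to `p`. -/
lemma exists_frob : ∃ σ : GG p, ∀ N : ℕ, N.Coprime p → ∀ z : Om p, z ^ N = 1 → σ z = z ^ p := by
  let t : {N : ℕ // N.Coprime p} → Set (GG p) := fun N => ⋂ z : {z : Om p // z ^ N.1 = 1}, {σ | σ z.1 = z.1 ^ p}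
  have hc : ∀ N, IsClosed (t N) := fun N => isClosed_iInter fun z => isClosed_map_eq _ _
  have hd : Directed (fun x1 x2 => x1 ⊇ x2) t := by
    intro N M
    refine ⟨⟨N.1 * M.1, Nat.Coprime.mul_left N.2 M.2⟩, ?_, ?_⟩
    · intro σ hσ
      rw [Set.mem_iInter] at hσ ⊢
      rintro ⟨z, hz⟩
      exact hσ ⟨z, by simp only; rw [pow_mul, hz, one_pow]⟩
    · intro σ hσ
      rw [Set.mem_iInter] at hσ ⊢
      rintro ⟨z, hz⟩
      exact hσ ⟨z, by simp only; rw [mul_comm, pow_mul, hz, one_pow]⟩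
  haveI : Nonempty {N : ℕ // N.Coprime p} := ⟨⟨1, Nat.coprime_one_left p⟩⟩
  obtain ⟨σ, hσ⟩ := IsCompact.nonempty_iInter_of_directed_nonempty_isCompact_isClosed t hd (by
    rintro ⟨N, hN⟩
    obtain ⟨σ, h⟩ := exists_frob_aux hN
    exact ⟨σ, Set.mem_iInter.2 fun z => h z.1 z.2⟩) (fun N => (hc N).isCompact) hc
  refine ⟨σ, fun N hN z hz => ?_⟩
  rw [Set.mem_iInter] at hσ
  have := hσ ⟨N, hN⟩
  rw [Set.mem_iInter] at this
  exact this ⟨z, hz⟩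

end KW

open Polynomial
namespace KW
variable {p : ℕ} [hp : Fact p.Prime]

lemma norm_algebraMap_zpow {a : ℚ_[p]} (ha : a ≠ 0) :
    ∃ k : ℤ, ‖algebraMap ℚ_[p] (Om p) a‖ = ‖(p : Om p)‖ ^ k := by
  refine ⟨a.valuation, ?_⟩
  rw [PadicAlgCl.norm_extends p, norm_natCast, Padic.norm_eq_zpow_neg_valuation ha, Padic.norm_p, inv_zpow,
    zpow_neg]

/-- Elements fixed by inertia have norm in the value group of `ℚ_p`. -/
lemma valT0 {x : Om p} (hx0 : x ≠ 0) (hx : ∀ σ ∈ II p, σ x = x) : ∃ k : ℤ, ‖x‖ = ‖(p : Om p)‖ ^ k := by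
  obtain ⟨N, hN, hfix⟩ := smooth (p := p) (z := 1) (x := x) (fun σ hσ => hx σ (mem_JJ.1 hσ).1)
  have hN0 := ne_zero_of_coprime hN
  obtain ⟨ζ, hζ⟩ := exists_prim (p := p) N (Nat.pos_of_ne_zero hN0)
  have : NeZero N := ⟨hN0⟩
  have hi : IsIntegral ℚ_[p] ζ := Algebra.IsIntegral.isIntegral ζ
  have hmon := minpoly.monic hi
  have hxa : x ∈ IntermediateField.adjoin ℚ_[p] {ζ} := by
    refine mem_adjoin_of_fixed _ _ fun σ hσ => hfix σ (map_one σ) fun w hw => ?_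
    obtain ⟨i, -, rfl⟩ := hζ.eq_pow_of_pow_eq_one hw
    rw [map_pow, hσ ζ rfl]
  obtain ⟨P, hPd, hPx⟩ : ∃ P : ℚ_[p][X], P.degree < (minpoly ℚ_[p] ζ).degree ∧ aeval ζ P = x := by
    rw [← IntermediateField.mem_toSubalgebra,
      IntermediateField.adjoin_simple_toSubalgebra_of_isAlgebraic hi.isAlgebraic,
      Algebra.adjoin_singleton_eq_range_aeval] at hxa
    obtain ⟨P, hP⟩ := hxa
    refine ⟨P %ₘ minpoly ℚ_[p] ζ, degree_modByMonic_lt _ hmon, ?_⟩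
    rw [← hP]
    have := congrArg (aeval ζ) (modByMonic_add_div P (minpoly ℚ_[p] ζ))
    rw [map_add, map_mul, minpoly.aeval, zero_mul, add_zero] at this
    exact this
  have hP0 : P ≠ 0 := by rintro rfl; rw [map_zero] at hPx; exact hx0 hPx.symm
  obtain ⟨i₀, hi₀, hmax⟩ := Finset.exists_max_image P.support (fun i => ‖P.coeff i‖)
    (support_nonempty.2 hP0)
  set a := P.coeff i₀ with ha
  have ha0 : a ≠ 0 := mem_support_iff.1 hi₀
  have hapos : 0 < ‖a‖ := norm_pos_iff.2 ha0
  have hmax' : ∀ i, ‖P.coeff i‖ ≤ ‖a‖ := by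
    intro i
    by_cases h : P.coeff i = 0
    · rw [h, norm_zero]; exact hapos.le
    · exact hmax i (mem_support_iff.2 h)
  set Q := C a⁻¹ * P with hQ
  have hQl : Q ∈ lifts (algebraMap ℤ_[p] ℚ_[p]) := by
    rw [lifts_iff_coeff_lifts]
    intro n
    refine ⟨⟨Q.coeff n, ?_⟩, rfl⟩
    rw [hQ, coeff_C_mul, norm_mul, norm_inv]
    exact (inv_mul_le_one₀ hapos).2 (hmax' n)
  obtain ⟨Q₀, hQ₀⟩ := hQl
  have hQ₀ : Q₀.map (algebraMap ℤ_[p] ℚ_[p]) = Q := hQ₀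
  have hQ₀i : Q₀.coeff i₀ = 1 := by
    apply FaithfulSMul.algebraMap_injective ℤ_[p] ℚ_[p]
    rw [← coeff_map, hQ₀, hQ, coeff_C_mul, ← ha, inv_mul_cancel₀ ha0, map_one]
  have hQ₀d : Q₀.degree < (minpoly ℚ_[p] ζ).degree := by
    rw [← degree_map_eq_of_injective (FaithfulSMul.algebraMap_injective ℤ_[p] ℚ_[p]), hQ₀, hQ,
      degree_C_mul (inv_ne_zero ha0)]
    exact hPd
  have hev : ∀ y : Om p, aeval y Q₀ = algebraMap ℚ_[p] (Om p) a⁻¹ * aeval y P := by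
    intro y
    rw [← aeval_map_algebraMap ℚ_[p], hQ₀, hQ, map_mul, aeval_C]
  have hle : ‖aeval ζ Q₀‖ ≤ 1 := by
    have := (Q₀.eval₂ ι ⟨ζ, mem_OO.2 (norm_root hN0 hζ.pow_eq_one).le⟩).2
    rw [mem_OO, eval_coe] at this
    exact this
  have heq : ‖aeval ζ Q₀‖ = 1 := by
    refine le_antisymm hle (not_lt.1 fun hlt => ?_)
    set R := (Q₀.map PadicInt.toZMod).map (algebraMap (ZMod p) (kk p)) with hR
    have hRoot : ∀ r : (minpoly ℚ_[p] ζ).rootSet (Om p), ∃ σ : GG p, σ ζ = r := by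
      rintro ⟨r, hr⟩
      rw [mem_rootSet] at hr
      have hc : IsConjRoot ℚ_[p] ζ r := by
        rw [isConjRoot_iff_aeval_eq_zero hi]; exact hr.2
      rw [isConjRoot_iff_exists_algEquiv] at hc
      obtain ⟨σ, hσ⟩ := hc
      exact ⟨σ.symm, σ.symm_apply_eq.2 hσ.symm⟩
    have hrN : ∀ r : (minpoly ℚ_[p] ζ).rootSet (Om p), (r : Om p) ^ N = 1 := by
      intro r
      obtain ⟨σ, hσ⟩ := hRoot r
      rw [← hσ, ← map_pow, hζ.pow_eq_one, map_one]
    let f : (minpoly ℚ_[p] ζ).rootSet (Om p) → kk p := fun r =>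
      red ⟨r, mem_OO.2 (norm_root hN0 (hrN r)).le⟩
    have hf : Function.Injective f := by
      intro r s h
      rw [red_eq] at h
      exact Subtype.ext (root_eq hN (hrN r) (hrN s) h)
    have hz : ∀ r, R.eval (f r) = 0 := by
      intro r
      rw [hR, eval_map, ← eval_red, red_eq_zero, eval_coe]
      obtain ⟨σ, hσ⟩ := hRoot r
      simp only
      rw [← hσ]
      have : aeval (σ ζ) Q₀ = σ (aeval ζ Q₀) := by
        rw [hev, hev, map_mul, AlgEquiv.commutes, aeval_algEquiv]; rfl
      rw [this, norm_map]
      exact hlt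
    have hcard : Fintype.card ((minpoly ℚ_[p] ζ).rootSet (Om p)) = (minpoly ℚ_[p] ζ).natDegree :=
      card_rootSet_eq_natDegree (minpoly.irreducible hi).separable (IsAlgClosed.splits _)
    have hR0 : R = 0 := by
      refine eq_zero_of_natDegree_lt_card_of_eval_eq_zero R hf hz ?_
      rw [hcard]
      have h1 : R.degree < (minpoly ℚ_[p] ζ).degree :=
        (degree_map_le.trans degree_map_le).trans_lt hQ₀d
      rw [degree_eq_natDegree hmon.ne_zero] at h1
      by_cases hR0 : R = 0
      · rw [hR0, natDegree_zero]; exact minpoly.natDegree_pos hi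
      · exact (natDegree_lt_iff_degree_lt hR0).2 h1
    have : R.coeff i₀ = 1 := by
      rw [hR, coeff_map, coeff_map, hQ₀i, map_one, map_one]
    rw [hR0, coeff_zero] at this
    exact zero_ne_one this
  obtain ⟨k, hk⟩ := norm_algebraMap_zpow (p := p) ha0
  refine ⟨k, ?_⟩
  rw [← hk]
  rw [hev, hPx, map_inv₀, norm_mul, norm_inv, inv_mul_eq_one₀] at heq
  · exact heq.symm
  · rw [PadicAlgCl.norm_extends p]; exact hapos.ne'
end KW

open Polynomial
namespace KW
variable {p : ℕ} [hp : Fact p.Prime]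

lemma norm_pow_sub_one_le {z : Om p} (hz : ‖z‖ ≤ 1) (a : ℕ) : ‖z ^ a - 1‖ ≤ ‖z - 1‖ := by
  rw [← mul_geom_sum, norm_mul]
  refine mul_le_of_le_one_right (norm_nonneg _) ?_
  refine IsUltrametricDist.norm_sum_le_of_forall_le_of_nonneg zero_le_one fun i _ => ?_
  rw [norm_pow]
  exact pow_le_one₀ (norm_nonneg _) hz

lemma norm_zeta_pow_sub {Z : Om p} {k : ℕ} (hZ : IsPrimitiveRoot Z (p ^ k)) {a : ℕ} (ha : a.Coprime p) :
    ‖Z ^ a - 1‖ = ‖Z - 1‖ := by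
  have hpk : p ^ k ≠ 0 := pow_ne_zero _ hp.1.ne_zero
  have hn := norm_root hpk hZ.pow_eq_one
  refine le_antisymm (norm_pow_sub_one_le hn.le a) ?_
  have : NeZero (p ^ k) := ⟨hpk⟩
  have h1 := hZ.pow_of_coprime a (ha.pow_right k)
  obtain ⟨i, -, hi⟩ := h1.eq_pow_of_pow_eq_one hZ.pow_eq_one
  conv_lhs => rw [← hi]
  exact norm_pow_sub_one_le (by rw [norm_pow, hn, one_pow]) i

lemma norm_zeta_sub_pow {Z : Om p} {k : ℕ} (hk : 0 < k) (hZ : IsPrimitiveRoot Z (p ^ k)) :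
    ‖Z - 1‖ ^ (p ^ k).totient = ‖(p : Om p)‖ := by
  have hpk : p ^ k ≠ 0 := pow_ne_zero _ hp.1.ne_zero
  have : NeZero (p ^ k) := ⟨hpk⟩
  obtain ⟨j, rfl⟩ : ∃ j, k = j + 1 := ⟨k - 1, by omega⟩
  have h1 : eval 1 (cyclotomic (p ^ (j + 1)) (Om p)) = p := eval_one_cyclotomic_prime_pow j
  rw [cyclotomic_eq_prod_X_sub_primitiveRoots hZ, eval_prod] at h1
  rw [← h1, norm_prod]
  rw [← hZ.card_primitiveRoots]
  symm
  refine Finset.prod_eq_pow_card fun w hw => ?_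
  rw [mem_primitiveRoots (Nat.pos_of_ne_zero hpk)] at hw
  obtain ⟨i, -, hi, rfl⟩ := (hZ.isPrimitiveRoot_iff).1 hw
  rw [eval_sub, eval_X, eval_C, norm_sub_rev]
  exact norm_zeta_pow_sub hZ (Nat.Coprime.coprime_dvd_right (dvd_pow_self p (by omega)) hi)

/-- Total ramification of the p-power cyclotomic tower. -/
lemma exists_tau {Z : Om p} {k : ℕ} (hk : 0 < k) (hZ : IsPrimitiveRoot Z (p ^ k)) {g : ℕ} (hg : g.Coprime p) :
    ∃ τ ∈ II p, τ Z = Z ^ g := by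
  classical
  have hpk : p ^ k ≠ 0 := pow_ne_zero _ hp.1.ne_zero
  have : NeZero (p ^ k) := ⟨hpk⟩
  let O := (primitiveRoots (p ^ k) (Om p)).filter (fun w => ∃ τ ∈ II p, τ Z = w)
  have hO : ∀ w, w ∈ O ↔ ∃ τ ∈ II p, τ Z = w := by
    intro w
    rw [Finset.mem_filter]
    refine ⟨fun h => h.2, fun h => ⟨?_, h⟩⟩
    obtain ⟨τ, -, rfl⟩ := h
    rw [mem_primitiveRoots (Nat.pos_of_ne_zero hpk)]
    exact hZ.map_of_injective τ.injective
  let y := ∏ w ∈ O, (w - 1)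
  have hy : ∀ σ ∈ II p, σ y = y := by
    intro σ hσ
    rw [map_prod]
    refine Finset.prod_bij (fun w _ => σ w) ?_ ?_ ?_ ?_
    · intro w hw
      rw [hO] at hw ⊢
      obtain ⟨τ, hτ, rfl⟩ := hw
      exact ⟨σ * τ, mul_mem hσ hτ, rfl⟩
    · intro a _ b _ h
      exact σ.injective h
    · intro b hb
      rw [hO] at hb
      obtain ⟨τ, hτ, rfl⟩ := hb
      refine ⟨σ⁻¹ (τ Z), (hO _).2 ⟨σ⁻¹ * τ, mul_mem (inv_mem hσ) hτ, rfl⟩, ?_⟩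
      exact σ.apply_symm_apply _
    · intro w _
      rw [map_sub, map_one]
  have hnorm : ∀ w ∈ O, ‖w - 1‖ = ‖Z - 1‖ := by
    intro w hw
    rw [hO] at hw
    obtain ⟨τ, hτ, rfl⟩ := hw
    rw [← norm_map τ (Z - 1), map_sub, map_one]
  have hpp := norm_zeta_sub_pow hk hZ
  have htot : 0 < (p ^ k).totient := Nat.totient_pos.2 (Nat.pos_of_ne_zero hpk)
  have hZ1 : Z - 1 ≠ 0 := by
    intro h
    rw [h, norm_zero, zero_pow htot.ne'] at hpp
    exact norm_p_pos.ne hpp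
  have hy0 : y ≠ 0 := by
    refine Finset.prod_ne_zero_iff.2 fun w hw => ?_
    rw [← norm_ne_zero_iff, hnorm w hw, norm_ne_zero_iff]
    exact hZ1
  obtain ⟨a, ha⟩ := valT0 hy0 hy
  have hya : ‖y‖ = ‖Z - 1‖ ^ O.card := by
    rw [norm_prod]
    exact Finset.prod_eq_pow_card hnorm
  have h1 : ‖(p : Om p)‖ ^ ((O.card : ℤ)) = ‖(p : Om p)‖ ^ (a * (p ^ k).totient) := by
    rw [zpow_mul, ← ha, hya, zpow_natCast, zpow_natCast, ← pow_mul, mul_comm, pow_mul, hpp]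
  have h2 := zpow_right_injective₀ norm_p_pos norm_p_lt.ne h1
  have hOpos : 0 < O.card := Finset.card_pos.2 ⟨Z, (hO Z).2 ⟨1, one_mem _, rfl⟩⟩
  have h3 : (p ^ k).totient ≤ O.card := Nat.le_of_dvd hOpos (by
    have : ((p ^ k).totient : ℤ) ∣ O.card := ⟨a, by rw [h2, mul_comm]⟩
    exact_mod_cast this)
  have h4 : O = primitiveRoots (p ^ k) (Om p) :=
    Finset.eq_of_subset_of_card_le (Finset.filter_subset _ _) (by rw [hZ.card_primitiveRoots]; exact h3)
  have h5 : Z ^ g ∈ O := by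
    rw [h4, mem_primitiveRoots (Nat.pos_of_ne_zero hpk)]
    exact hZ.pow_of_coprime g (hg.pow_right k)
  exact (hO _).1 h5

/-- A Frobenius fixing `Z`. -/
lemma exists_phi {Z : Om p} {k : ℕ} (hk : 0 < k) (hZ : IsPrimitiveRoot Z (p ^ k)) :
    ∃ φ : GG p, φ Z = Z ∧ ∀ N : ℕ, N.Coprime p → ∀ z : Om p, z ^ N = 1 → φ z = z ^ p := by
  obtain ⟨φ₀, h⟩ := exists_frob (p := p)
  have hpk : p ^ k ≠ 0 := pow_ne_zero _ hp.1.ne_zero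
  have : NeZero (p ^ k) := ⟨hpk⟩
  have h1 : IsPrimitiveRoot (φ₀ Z) (p ^ k) := hZ.map_of_injective φ₀.injective
  obtain ⟨i, -, hi, h2⟩ := (hZ.isPrimitiveRoot_iff).1 h1
  obtain ⟨τ, hτ, h3⟩ := exists_tau hk hZ (g := i) (Nat.Coprime.coprime_dvd_right (dvd_pow_self p (by omega)) hi)
  refine ⟨τ⁻¹ * φ₀, ?_, fun N hN z hz => ?_⟩
  · change τ⁻¹ (φ₀ Z) = Z
    rw [← h2, ← h3]
    exact τ.symm_apply_apply Z
  · change τ⁻¹ (φ₀ z) = z ^ p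
    rw [h N hN z hz]
    exact mem_II.1 (inv_mem hτ) N _ hN (by rw [← pow_mul, mul_comm, pow_mul, hz, one_pow])

end KW

open Polynomial
namespace KW
variable {p : ℕ} [hp : Fact p.Prime]

/-- The elements on which all automorphisms commute. -/
noncomputable def AbF (p : ℕ) [Fact p.Prime] : IntermediateField ℚ_[p] (Om p) where
  carrier := {x | ∀ σ τ : GG p, σ (τ x) = τ (σ x)}
  mul_mem' := fun {x y} hx hy σ τ => by simp only [map_mul]; rw [hx σ τ, hy σ τ]
  add_mem' := fun {x y} hx hy σ τ => by simp only [map_add]; rw [hx σ τ, hy σ τ]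
  algebraMap_mem' := fun a σ τ => by simp only [AlgEquiv.commutes]
  inv_mem' := fun x hx σ τ => by simp only [map_inv₀]; rw [hx σ τ]

lemma mem_AbF {x : Om p} : x ∈ AbF p ↔ ∀ σ τ : GG p, σ (τ x) = τ (σ x) := Iff.rfl

lemma AbF_map {x : Om p} (hx : x ∈ AbF p) (τ : GG p) : τ x ∈ AbF p := by
  intro σ ρ
  have h1 := hx σ (ρ * τ)
  have h2 := hx τ σ
  change σ (ρ (τ x)) = ρ (τ (σ x)) at h1
  rw [h1, h2]

lemma exists_map_root (σ : GG p) {z : Om p} {N : ℕ} (hN : 0 < N) (hz : IsPrimitiveRoot z N) :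
    ∃ i : ℕ, i.Coprime N ∧ σ z = z ^ i := by
  have h1 : IsPrimitiveRoot (σ z) N := hz.map_of_injective σ.injective
  have : NeZero N := ⟨hN.ne'⟩
  obtain ⟨i, -, hi, h2⟩ := (hz.isPrimitiveRoot_iff).1 h1
  exact ⟨i, hi, h2.symm⟩

lemma AbF_root {z : Om p} {N : ℕ} (hN : 0 < N) (hz : z ^ N = 1) : z ∈ AbF p := by
  obtain ⟨ζ, hζ⟩ := exists_prim (p := p) N hN
  have : NeZero N := ⟨hN.ne'⟩
  obtain ⟨i, -, rfl⟩ := hζ.eq_pow_of_pow_eq_one hz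
  refine pow_mem ?_ i
  intro σ τ
  obtain ⟨a, -, ha⟩ := exists_map_root σ hN hζ
  obtain ⟨b, -, hb⟩ := exists_map_root τ hN hζ
  rw [ha, hb, map_pow, map_pow, ha, hb, ← pow_mul, ← pow_mul, mul_comm]

lemma zeta_sub_ne {Z : Om p} {k : ℕ} (hk : 0 < k) (hZ : IsPrimitiveRoot Z (p ^ k)) : Z - 1 ≠ 0 := by
  have hpp := norm_zeta_sub_pow hk hZ
  have htot : 0 < (p ^ k).totient := Nat.totient_pos.2 (pow_pos hp.1.pos _)
  intro h
  rw [h, norm_zero, zero_pow htot.ne'] at hpp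
  exact norm_p_pos.ne hpp

lemma zeta_sub_lt {Z : Om p} {k : ℕ} (hk : 0 < k) (hZ : IsPrimitiveRoot Z (p ^ k)) : ‖Z - 1‖ < 1 := by
  have hpp := norm_zeta_sub_pow hk hZ
  have htot : 0 < (p ^ k).totient := Nat.totient_pos.2 (pow_pos hp.1.pos _)
  by_contra h
  push Not at h
  have := one_le_pow₀ h (n := (p ^ k).totient)
  rw [hpp] at this
  exact absurd norm_p_lt (not_lt.2 this)

lemma valT {Z : Om p} {k : ℕ} (hk : 0 < k) (hZ : IsPrimitiveRoot Z (p ^ k)) {x : Om p} (hx0 : x ≠ 0)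
    (hx : ∀ σ ∈ JJ Z, σ x = x) : ∃ a : ℤ, ‖x‖ = ‖Z - 1‖ ^ a := by
  have hpk : 0 < p ^ k := pow_pos hp.1.pos _
  have h1 : ∀ w : Om p, ∃ τ : GG p, IsPrimitiveRoot w (p ^ k) → τ ∈ II p ∧ τ Z = w := by
    intro w
    by_cases hw : IsPrimitiveRoot w (p ^ k)
    · have : NeZero (p ^ k) := ⟨hpk.ne'⟩
      obtain ⟨i, -, hi, rfl⟩ := (hZ.isPrimitiveRoot_iff).1 hw
      obtain ⟨τ, h1, h2⟩ := exists_tau hk hZ (Nat.Coprime.coprime_dvd_right (dvd_pow_self p hk.ne') hi)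
      exact ⟨τ, fun _ => ⟨h1, h2⟩⟩
    · exact ⟨1, fun h => absurd h hw⟩
  choose T hT using h1
  let y := ∏ w ∈ primitiveRoots (p ^ k) (Om p), T w x
  have hy : ∀ σ ∈ II p, σ y = y := by
    intro σ hσ
    rw [map_prod]
    refine Finset.prod_bij (fun w _ => σ w) ?_ ?_ ?_ ?_
    · intro w hw
      rw [mem_primitiveRoots hpk] at hw ⊢
      exact hw.map_of_injective σ.injective
    · intro a _ b _ h
      exact σ.injective h
    · intro b hb
      rw [mem_primitiveRoots hpk] at hb
      refine ⟨σ⁻¹ b, ?_, σ.apply_symm_apply _⟩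
      rw [mem_primitiveRoots hpk]
      exact hb.map_of_injective (σ⁻¹).injective
    · intro w hw
      rw [mem_primitiveRoots hpk] at hw
      have hw' : IsPrimitiveRoot (σ w) (p ^ k) := hw.map_of_injective σ.injective
      have h2 : (T (σ w))⁻¹ * σ * T w ∈ JJ Z := by
        rw [mem_JJ]
        refine ⟨mul_mem (mul_mem (inv_mem (hT _ hw').1) hσ) (hT _ hw).1, ?_⟩
        change (T (σ w))⁻¹ (σ (T w Z)) = Z
        rw [(hT _ hw).2]
        exact (AlgEquiv.symm_apply_eq (T (σ w))).2 (hT _ hw').2.symm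
      have h3 := hx _ h2
      change (T (σ w)).symm (σ (T w x)) = x at h3
      rwa [AlgEquiv.symm_apply_eq] at h3
  have hny : ‖y‖ = ‖x‖ ^ (p ^ k).totient := by
    rw [norm_prod, ← hZ.card_primitiveRoots]
    exact Finset.prod_eq_pow_card fun w _ => norm_map _ _
  have htot : 0 < (p ^ k).totient := Nat.totient_pos.2 hpk
  have hy0 : y ≠ 0 := by
    rw [← norm_ne_zero_iff, hny]
    exact pow_ne_zero _ (norm_ne_zero_iff.2 hx0)
  obtain ⟨a, ha⟩ := valT0 hy0 hy
  refine ⟨a, ?_⟩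
  have h4 : ‖x‖ ^ (p ^ k).totient = (‖Z - 1‖ ^ a) ^ (p ^ k).totient := by
    rw [← hny, ha, ← norm_zeta_sub_pow hk hZ, ← zpow_natCast, ← zpow_natCast, ← zpow_mul, ← zpow_mul, mul_comm]
  exact (pow_left_inj₀ (norm_nonneg _) (zpow_nonneg (norm_nonneg _) _) htot.ne').1 h4

lemma normalize {α l : Om p} (hl : l ≠ 0) {j : ℤ} (h : ‖α‖ = ‖l‖ ^ j) :
    ∃ (c : Om p) (N : ℕ), 0 < N ∧ N.Coprime p ∧ c ^ N = 1 ∧ ‖α / (c * l ^ j) - 1‖ < 1 := by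
  obtain ⟨c, N, h1, h2, h3, h4⟩ := exists_teich (p := p) (t := α / l ^ j) (by
    rw [norm_div, norm_zpow, h, div_self]
    exact zpow_ne_zero _ (norm_ne_zero_iff.2 hl))
  refine ⟨c, N, h1, h2, h3, ?_⟩
  have hc := norm_root h1.ne' h3
  have hc0 : c ≠ 0 := by rintro rfl; simp at hc
  have hlj : l ^ j ≠ 0 := zpow_ne_zero _ hl
  have : α / (c * l ^ j) - 1 = (α / l ^ j - c) / c := by field_simp
  rw [this, norm_div, hc, div_one]
  exact h4

lemma norm_eq_of_sub_one {x : Om p} (h : ‖x - 1‖ < 1) : ‖x‖ = 1 := by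
  have := IsUltrametricDist.norm_eq_of_add_norm_lt_max (x := x) (y := -1) (by
    rw [← sub_eq_add_neg, norm_neg, norm_one]
    exact h.trans_le (le_max_right _ _))
  simpa using this

lemma tame {ζ : Om p} (hζ : IsPrimitiveRoot ζ p) {α : Om p} (hα : α ∈ AbF p) {m : ℕ} (hm : m.Coprime p)
    (h : ∀ σ ∈ II p, ∃ ξ : Om p, ξ ^ m = 1 ∧ σ α = ξ * α) : ∀ σ ∈ JJ ζ, σ α = α := by
  by_cases hα0 : α = 0
  · intro σ _; rw [hα0, map_zero]
  have hζ1 : IsPrimitiveRoot ζ (p ^ 1) := by rwa [pow_one]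
  have hl := zeta_sub_ne one_pos hζ1
  have hpl := norm_zeta_sub_pow one_pos hζ1
  rw [pow_one, Nat.totient_prime hp.1] at hpl
  obtain ⟨φ, -, hφ⟩ := exists_phi one_pos hζ1
  have hp1 : 0 < p - 1 := by have := hp.1.two_le; omega
  have hval : ∃ j : ℤ, ‖α‖ = ‖ζ - 1‖ ^ j := by
    have hφ0 : φ α ≠ 0 := (map_ne_zero φ).2 hα0
    obtain ⟨a, ha⟩ := valT0 (x := α ^ p / φ α) (div_ne_zero (pow_ne_zero _ hα0) hφ0) (by
      intro σ hσ
      obtain ⟨ξ, hξ, h1⟩ := h σ hσ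
      have hξ0 : ξ ≠ 0 := by
        rintro rfl
        rw [zero_pow (ne_zero_of_coprime hm)] at hξ
        exact zero_ne_one hξ
      rw [map_div₀, map_pow, hα σ φ, h1, map_mul, hφ m hm ξ hξ, mul_pow]
      exact mul_div_mul_left _ _ (pow_ne_zero _ hξ0))
    refine ⟨a, ?_⟩
    have h4 : ‖α‖ ^ (p - 1) = (‖ζ - 1‖ ^ a) ^ (p - 1) := by
      rw [norm_div, norm_pow, norm_map] at ha
      have : ‖α‖ ^ p / ‖α‖ = ‖α‖ ^ (p - 1) := by
        rw [div_eq_iff (norm_ne_zero_iff.2 hα0), ← pow_succ, Nat.sub_add_cancel hp.1.one_le]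
      rw [← this, ha, ← hpl, ← zpow_natCast, ← zpow_natCast, ← zpow_mul, ← zpow_mul, mul_comm]
    exact (pow_left_inj₀ (norm_nonneg _) (zpow_nonneg (norm_nonneg _) _) hp1.ne').1 h4
  obtain ⟨j, hj⟩ := hval
  obtain ⟨c, N, hN0, hN, hc, hlt⟩ := normalize hl hj
  intro σ hσ
  rw [mem_JJ] at hσ
  obtain ⟨ξ, hξ, h1⟩ := h σ hσ.1
  set β := α / (c * (ζ - 1) ^ j) with hβ
  have h2 : σ β = ξ * β := by
    rw [hβ, map_div₀, map_mul, map_zpow₀, map_sub, map_one, hσ.2, mem_II.1 hσ.1 N c hN hc, h1, mul_div_assoc]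
  have hβ1 := norm_eq_of_sub_one hlt
  have h3 : ‖ξ - 1‖ < 1 := by
    have : (ξ - 1) * β = σ (β - 1) - (β - 1) := by rw [map_sub, h2, map_one]; ring
    have h4 : ‖(ξ - 1) * β‖ < 1 := by
      rw [this]; exact norm_sub_lt' (by rwa [norm_map]) hlt
    rwa [norm_mul, hβ1, mul_one] at h4
  rw [h1, root_eq_one hm hξ h3, one_mul]

end KW

open Polynomial
namespace KW
variable {p : ℕ} [hp : Fact p.Prime]

/-- Equality up to principal units. -/
def Sim (x y : Om p) : Prop := x ≠ 0 ∧ y ≠ 0 ∧ ‖x / y - 1‖ < 1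

lemma Sim.refl {x : Om p} (h : x ≠ 0) : Sim x x := ⟨h, h, by rw [div_self h]; simp⟩

lemma Sim.of_lt {x y : Om p} (h : ‖x - y‖ < ‖y‖) : Sim x y := by
  have hy : y ≠ 0 := by
    rintro rfl
    simp only [norm_zero] at h
    exact absurd h (not_lt.2 (norm_nonneg _))
  refine ⟨?_, hy, ?_⟩
  · rintro rfl
    rw [zero_sub, norm_neg] at h
    exact lt_irrefl _ h
  · have : x / y - 1 = (x - y) / y := by field_simp
    rw [this, norm_div, div_lt_one (norm_pos_iff.2 hy)]
    exact h

lemma Sim.lt {x y : Om p} (h : Sim x y) : ‖x - y‖ < ‖y‖ := by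
  obtain ⟨-, hy, h⟩ := h
  have : x / y - 1 = (x - y) / y := by field_simp
  rwa [this, norm_div, div_lt_one (norm_pos_iff.2 hy)] at h

lemma Sim.norm_eq {x y : Om p} (h : Sim x y) : ‖x‖ = ‖y‖ := by
  have := norm_eq_of_sub_one h.2.2
  rwa [norm_div, div_eq_one_iff_eq (norm_ne_zero_iff.2 h.2.1)] at this

lemma Sim.symm {x y : Om p} (h : Sim x y) : Sim y x :=
  Sim.of_lt (by rw [norm_sub_rev, h.norm_eq]; exact h.lt)

lemma U1_mul {u v : Om p} (hu : ‖u - 1‖ < 1) (hv : ‖v - 1‖ < 1) : ‖u * v - 1‖ < 1 := by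
  have : u * v - 1 = u * (v - 1) + (u - 1) := by ring
  rw [this]
  refine norm_add_lt' ?_ hu
  rw [norm_mul, norm_eq_of_sub_one hu, one_mul]
  exact hv

lemma Sim.mul {x y z w : Om p} (h : Sim x y) (h' : Sim z w) : Sim (x * z) (y * w) := by
  refine ⟨mul_ne_zero h.1 h'.1, mul_ne_zero h.2.1 h'.2.1, ?_⟩
  rw [mul_div_mul_comm]
  exact U1_mul h.2.2 h'.2.2

lemma Sim.trans {x y z : Om p} (h : Sim x y) (h' : Sim y z) : Sim x z := by
  refine ⟨h.1, h'.2.1, ?_⟩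
  have : x / z = (x / y) * (y / z) := by
    have := h.2.1
    field_simp
  rw [this]
  exact U1_mul h.2.2 h'.2.2

lemma Sim.pow {x y : Om p} (h : Sim x y) (n : ℕ) : Sim (x ^ n) (y ^ n) := by
  induction n with
  | zero => rw [pow_zero, pow_zero]; exact Sim.refl one_ne_zero
  | succ n ih => rw [pow_succ, pow_succ]; exact ih.mul h

lemma Sim.map {x y : Om p} (h : Sim x y) (σ : GG p) : Sim (σ x) (σ y) := by
  apply Sim.of_lt
  rw [← map_sub, norm_map, norm_map]
  exact h.lt

lemma Sim.cancel {x y z w : Om p} (h : Sim (x * z) (y * w)) (h' : Sim z w) : Sim x y := by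
  have hx := left_ne_zero_of_mul h.1
  have hy := left_ne_zero_of_mul h.2.1
  refine ⟨hx, hy, ?_⟩
  have h2 := U1_mul h.2.2 h'.symm.2.2
  have hz := h'.1
  have hw := h'.2.1
  have : x * z / (y * w) * (w / z) = x / y := by field_simp
  rwa [this] at h2

/-- binomial expansion -/
lemma pow_p_approx {x : Om p} (hx : ‖x - 1‖ ≤ 1) : ‖x ^ p - 1 - (x - 1) ^ p‖ ≤ ‖(p : Om p)‖ * ‖x - 1‖ := by
  let y : OO p := ⟨x - 1, mem_OO.2 hx⟩
  obtain ⟨r, hr⟩ := exists_add_pow_prime_eq hp.1 (1 : OO p) y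
  have h1 := congrArg (fun t : OO p => (t : Om p)) hr
  simp only [y, one_pow, mul_one] at h1
  push_cast at h1
  rw [add_sub_cancel] at h1
  have h2 : x ^ p - 1 - (x - 1) ^ p = p * (x - 1) * r := by rw [h1]; ring
  rw [h2, norm_mul, norm_mul]
  exact mul_le_of_le_one_right (by positivity) (mem_OO.1 r.2)

lemma U1_of_pow {u : Om p} (hu : ‖u ^ p - 1‖ < 1) : ‖u - 1‖ < 1 := by
  have h1 : ‖u‖ = 1 := by
    have := norm_eq_of_sub_one hu
    rw [norm_pow] at this
    exact (pow_eq_one_iff_of_nonneg (norm_nonneg _) hp.1.ne_zero).1 this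
  have h2 : ‖u - 1‖ ≤ 1 := norm_sub_le' h1.le (by simp)
  have h3 := pow_p_approx h2
  have h4 : ‖(u - 1) ^ p‖ < 1 := by
    have : (u - 1) ^ p = (u ^ p - 1) - (u ^ p - 1 - (u - 1) ^ p) := by ring
    rw [this]
    refine norm_sub_lt' hu (h3.trans_lt ?_)
    calc _ ≤ ‖(p : Om p)‖ * 1 := by gcongr
      _ < 1 := by rw [mul_one]; exact norm_p_lt
  by_contra h
  push Not at h
  rw [norm_pow] at h4
  exact absurd h4 (not_lt.2 (one_le_pow₀ h))

lemma pow_approx {x : Om p} (hx : ‖x - 1‖ < 1) (g : ℕ) : ‖x ^ g - 1 - g * (x - 1)‖ ≤ ‖x - 1‖ ^ 2 := by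
  induction g with
  | zero => simp
  | succ g ih =>
    have : x ^ (g + 1) - 1 - ((g + 1 : ℕ) : Om p) * (x - 1) = (x ^ g - 1 - g * (x - 1)) + (x ^ g - 1) * (x - 1) := by
      push_cast; ring
    rw [this]
    refine norm_add_le' ih ?_
    rw [norm_mul, sq]
    gcongr
    exact norm_pow_sub_one_le (norm_eq_of_sub_one hx).le g

lemma norm_cast_of {x : Om p} (hx : ‖x - 1‖ < 1) (hx0 : x - 1 ≠ 0) {g : ℕ} (hg : g.Coprime p) :
    Sim (x ^ g - 1) ((g : Om p) * (x - 1)) := by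
  apply Sim.of_lt
  refine (pow_approx hx g).trans_lt ?_
  rw [norm_mul, norm_natCast_eq hg, one_mul, sq]
  exact mul_lt_of_lt_one_left (norm_pos_iff.2 hx0) hx

lemma pow_p_sim {x l : Om p} (hl : ‖l‖ ^ (p - 1) = ‖(p : Om p)‖) (hx : ‖x - 1‖ < 1) (hlx : ‖l‖ < ‖x - 1‖) :
    Sim (x ^ p - 1) ((x - 1) ^ p) := by
  apply Sim.of_lt
  refine (pow_p_approx hx.le).trans_lt ?_
  rw [norm_pow, ← hl]
  have : ‖x - 1‖ ^ p = ‖x - 1‖ ^ (p - 1) * ‖x - 1‖ := by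
    rw [← pow_succ, Nat.sub_add_cancel hp.1.one_le]
  rw [this]
  have h1 : 0 < ‖x - 1‖ := (norm_nonneg _).trans_lt hlx
  refine mul_lt_mul_of_pos_right ?_ h1
  exact pow_lt_pow_left₀ hlx (norm_nonneg _) (by have := hp.1.two_le; omega)

end KW

open Polynomial
namespace KW
variable {p : ℕ} [hp : Fact p.Prime]

/-- Kummer generators over the fixed field of `JJ ζ`. -/
def Wk (ζ α : Om p) : Prop := α ∈ AbF p ∧ α ≠ 0 ∧ ∀ σ ∈ JJ ζ, σ (α ^ p) = α ^ p

lemma Wk.div {ζ α β : Om p} (h : Wk ζ α) (h' : Wk ζ β) : Wk ζ (α / β) :=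
  ⟨div_mem h.1 h'.1, div_ne_zero h.2.1 h'.2.1, fun σ hσ => by
    rw [div_pow, map_div₀, h.2.2 σ hσ, h'.2.2 σ hσ]⟩

lemma Wk.of_fixed {ζ α : Om p} (h : α ∈ AbF p) (h0 : α ≠ 0) (h' : ∀ σ ∈ JJ ζ, σ α = α) : Wk ζ α :=
  ⟨h, h0, fun σ hσ => by rw [map_pow, h' σ hσ]⟩

lemma Wk.exists_xi {ζ α : Om p} (h : Wk ζ α) {σ : GG p} (hσ : σ ∈ JJ ζ) : ∃ ξ : Om p, ξ ^ p = 1 ∧ σ α = ξ * α := by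
  refine ⟨σ α / α, ?_, by rw [div_mul_cancel₀ _ h.2.1]⟩
  rw [div_pow, ← map_pow, h.2.2 σ hσ, div_self (pow_ne_zero _ h.2.1)]

lemma Wk.twist {ζ α : Om p} (hζ : IsPrimitiveRoot ζ p) (h : Wk ζ α) {τ : GG p} {w : ℕ} (hτ : τ ζ = ζ ^ w) :
    ∀ σ ∈ JJ ζ, σ (τ α / α ^ w) = τ α / α ^ w := by
  intro σ hσ
  obtain ⟨ξ, hξ, h1⟩ := h.exists_xi hσ
  have : NeZero p := ⟨hp.1.ne_zero⟩
  obtain ⟨i, -, rfl⟩ := hζ.eq_pow_of_pow_eq_one hξ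
  rw [map_div₀, map_pow, h.1 σ τ, h1, map_mul, map_pow, hτ, mul_pow, ← pow_mul, ← pow_mul, mul_comm w i]
  exact mul_div_mul_left _ _ (pow_ne_zero _ (hζ.ne_zero hp.1.ne_zero))

lemma hprim1 {ζ : Om p} (hζ : IsPrimitiveRoot ζ p) : IsPrimitiveRoot ζ (p ^ 1) := by rwa [pow_one]

lemma norm_lam {ζ : Om p} (hζ : IsPrimitiveRoot ζ p) : ‖ζ - 1‖ ^ (p - 1) = ‖(p : Om p)‖ := by
  have := norm_zeta_sub_pow one_pos (hprim1 hζ)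
  rwa [pow_one, Nat.totient_prime hp.1] at this

lemma lam_ne {ζ : Om p} (hζ : IsPrimitiveRoot ζ p) : ζ - 1 ≠ 0 := zeta_sub_ne one_pos (hprim1 hζ)
lemma lam_lt {ζ : Om p} (hζ : IsPrimitiveRoot ζ p) : ‖ζ - 1‖ < 1 := zeta_sub_lt one_pos (hprim1 hζ)

lemma W0 {ζ α : Om p} (hζ : IsPrimitiveRoot ζ p) (h : Wk ζ α) (hy : ‖α - 1‖ ≤ ‖ζ - 1‖) :
    ∀ σ ∈ JJ ζ, σ α = α := by
  have hl := lam_ne hζ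
  have hl1 := lam_lt hζ
  obtain ⟨c, hc, hcn, hct⟩ : ∃ c : Om p, (∀ σ ∈ II p, σ c = c) ∧ ‖c‖ ≤ 1 ∧ ‖(α - 1) / (ζ - 1) - c‖ < 1 := by
    by_cases ht : ‖(α - 1) / (ζ - 1)‖ < 1
    · exact ⟨0, fun σ _ => map_zero σ, by simp, by rwa [sub_zero]⟩
    · have : ‖(α - 1) / (ζ - 1)‖ = 1 := by
        refine le_antisymm ?_ (not_lt.1 ht)
        rw [norm_div]
        exact div_le_one_of_le₀ hy (norm_nonneg _)
      obtain ⟨c, N, h1, h2, h3, h4⟩ := exists_teich this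
      exact ⟨c, fun σ hσ => mem_II.1 hσ N c h2 h3, (norm_root h1.ne' h3).le, h4⟩
  set u := 1 + c * (ζ - 1) with hu
  have hu1 : ‖u‖ = 1 := by
    apply norm_eq_of_sub_one
    rw [hu, add_sub_cancel_left, norm_mul]
    exact (mul_le_of_le_one_left (norm_nonneg _) hcn).trans_lt hl1
  have hu0 : u ≠ 0 := by intro h; rw [h, norm_zero] at hu1; exact zero_ne_one hu1
  set β := α / u with hβ
  have hβ1 : ‖β - 1‖ < ‖ζ - 1‖ := by
    have : β - 1 = ((α - 1) / (ζ - 1) - c) * (ζ - 1) / u := by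
      rw [hβ, sub_mul, div_mul_cancel₀ _ hl, div_sub_one hu0, hu]
      congr 1
      ring
    rw [this, norm_div, hu1, div_one, norm_mul]
    exact mul_lt_of_lt_one_left (norm_pos_iff.2 hl) hct
  have hβn := norm_eq_of_sub_one (hβ1.trans hl1)
  intro σ hσ
  obtain ⟨ξ, hξ, h1⟩ := h.exists_xi hσ
  rw [mem_JJ] at hσ
  have h2 : σ β = ξ * β := by
    rw [hβ, map_div₀, hu, map_add, map_one, map_mul, map_sub, map_one, hσ.2, hc σ hσ.1, h1, mul_div_assoc]
  have h3 : ‖ξ - 1‖ < ‖ζ - 1‖ := by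
    have : (ξ - 1) * β = σ (β - 1) - (β - 1) := by rw [map_sub, h2, map_one]; ring
    have h4 : ‖(ξ - 1) * β‖ < ‖ζ - 1‖ := by
      rw [this]; exact norm_sub_lt' (by rwa [norm_map]) hβ1
    rwa [norm_mul, hβn, mul_one] at h4
  have : NeZero p := ⟨hp.1.ne_zero⟩
  obtain ⟨i, hi, rfl⟩ := hζ.eq_pow_of_pow_eq_one hξ
  by_cases hi0 : i = 0
  · rw [h1, hi0, pow_zero, one_mul]
  · exfalso
    rw [norm_zeta_pow_sub (hprim1 hζ) (Nat.coprime_of_lt_prime hi0 hi hp.1).symm] at h3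
    exact lt_irrefl _ h3

/-- action of an automorphism on a big Kummer generator -/
lemma sim_tau {ζ α : Om p} (hζ : IsPrimitiveRoot ζ p) (h : Wk ζ α) (hy : ‖α - 1‖ < 1) (hly : ‖ζ - 1‖ < ‖α - 1‖)
    {τ : GG p} {g : ℕ} (hg : g.Coprime p) (hτ : τ ζ = ζ ^ g) : Sim (τ (α - 1)) ((g : Om p) * (α - 1)) := by
  have hl := lam_ne hζ
  have hl1 := lam_lt hζ
  have hαn := norm_eq_of_sub_one hy
  have hy0 : 0 < ‖α - 1‖ := (norm_nonneg _).trans_lt hly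
  set c := τ α / α ^ g with hc
  have hα0 := h.2.1
  have hαg : ‖α ^ g‖ = 1 := by rw [norm_pow, hαn, one_pow]
  have h1 : τ α = α ^ g * c := by rw [hc]; field_simp
  have hc1 : ‖c - 1‖ < ‖α - 1‖ := by
    by_cases hc0 : c - 1 = 0
    · rw [hc0, norm_zero]; exact hy0
    have hle : ‖c - 1‖ ≤ ‖α - 1‖ := by
      have : c - 1 = (τ (α - 1) - (α ^ g - 1)) / α ^ g := by
        rw [map_sub, map_one, h1]; field_simp; ring
      rw [this, norm_div, hαg, div_one]
      exact norm_sub_le' (norm_map _ _).le (norm_pow_sub_one_le hαn.le g)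
    obtain ⟨a, ha⟩ := valT one_pos (hprim1 hζ) hc0 (fun σ hσ => by
      rw [map_sub, map_one, h.twist hζ hτ σ hσ])
    have ha1 : 0 < a := by
      by_contra h0
      push Not at h0
      have := one_le_zpow_of_nonpos₀ (norm_pos_iff.2 hl) hl1.le h0
      rw [← ha] at this
      linarith
    rw [ha]
    calc ‖ζ - 1‖ ^ a ≤ ‖ζ - 1‖ ^ (1 : ℤ) :=
          zpow_le_zpow_right_of_le_one₀ (norm_pos_iff.2 hl) hl1.le (by omega)
      _ = ‖ζ - 1‖ := zpow_one _
      _ < _ := hly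
  apply Sim.of_lt
  rw [norm_mul, norm_natCast_eq hg, one_mul]
  have : τ (α - 1) - (g : Om p) * (α - 1) = (α ^ g - 1 - (g : Om p) * (α - 1)) + α ^ g * (c - 1) := by
    rw [map_sub, map_one, h1]; ring
  rw [this]
  refine norm_add_lt' ((pow_approx hy g).trans_lt ?_) ?_
  · rw [sq]
    exact mul_lt_of_lt_one_left hy0 hy
  · rwa [norm_mul, hαg, one_mul]

end KW

open Polynomial
namespace KW
variable {p : ℕ} [hp : Fact p.Prime]

lemma exists_primroot (p : ℕ) [hp : Fact p.Prime] : ∃ g : ℕ, g.Coprime p ∧ orderOf (g : ZMod p) = p - 1 := by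
  obtain ⟨u, hu⟩ := IsCyclic.exists_generator (α := (ZMod p)ˣ)
  have h1 : orderOf u = p - 1 := by
    rw [orderOf_eq_card_of_forall_mem_zpowers hu, Nat.card_eq_fintype_card, ZMod.card_units]
  refine ⟨(u : ZMod p).val, ZMod.val_coe_unit_coprime u, ?_⟩
  rw [ZMod.natCast_zmod_val, orderOf_units, h1]

lemma sim_natCast {a b : ℕ} (h : Sim (a : Om p) (b : Om p)) : (a : ZMod p) = (b : ZMod p) := by
  have h1 := h.lt.trans_le (norm_natCast_le b)
  have : ((a : Om p) - (b : Om p)) = ((a - b : ℤ) : Om p) := by push_cast; ring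
  rw [this, norm_intCast_lt] at h1
  rw [← sub_eq_zero]
  have := (ZMod.intCast_zmod_eq_zero_iff_dvd (a - b : ℤ) p).2 h1
  push_cast at this
  exact this

/-- a root of unity congruent to its p-th power is congruent to an integer -/
lemma exists_nat_sim {b : Om p} (hb : ‖b‖ = 1) (h : Sim (b ^ p) b) : ∃ j : ℕ, j.Coprime p ∧ Sim b (j : Om p) := by
  let x : OO p := ⟨b, mem_OO.2 hb.le⟩
  have h1 : (red x) ^ p = red x := by
    rw [← map_pow, red_eq]
    have := h.lt
    rw [hb] at this
    exact this
  obtain ⟨n, hn⟩ := mem_range_of_pow h1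
  have h2 : red x = red ((n.val : ℕ) : OO p) := by
    rw [← hn, map_natCast, ← map_natCast (algebraMap (ZMod p) (kk p)), ZMod.natCast_zmod_val]
  rw [red_eq] at h2
  have h3 : ‖b - (n.val : Om p)‖ < 1 := by
    have e : (((n.val : ℕ) : OO p) : Om p) = ((n.val : ℕ) : Om p) := map_natCast (OO p).subtype _
    rw [← e]; exact h2
  have h4 : Sim (n.val : Om p) b := Sim.of_lt (by rw [norm_sub_rev, hb]; exact h3)
  refine ⟨n.val, ?_, h4.symm⟩
  rw [Nat.coprime_comm, Nat.Prime.coprime_iff_not_dvd hp.1, ← norm_natCast_lt, h4.norm_eq, hb]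
  exact lt_irrefl _

lemma W1 {ζ ζ' α : Om p} (hζ' : IsPrimitiveRoot ζ' (p ^ 2)) (hζζ : ζ' ^ p = ζ) (hζ : IsPrimitiveRoot ζ p)
    (h : Wk ζ α) (hy : ‖α - 1‖ < 1) (hly : ‖ζ - 1‖ < ‖α - 1‖) :
    ‖α - 1‖ = ‖ζ' - 1‖ ∧ ∃ j : ℕ, ‖α / ζ' ^ j - 1‖ < ‖ζ' - 1‖ := by
  have hl := lam_ne hζ
  have hl1 := lam_lt hζ
  have hlp := norm_lam hζ
  have hp1 : 0 < p - 1 := by have := hp.1.two_le; omega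
  have hy0 : 0 < ‖α - 1‖ := (norm_nonneg _).trans_lt hly
  have hρ := zeta_sub_ne two_pos hζ'
  have hρ1 := zeta_sub_lt two_pos hζ'
  have hρp : ‖ζ' - 1‖ ^ p = ‖ζ - 1‖ := by
    have h1 := norm_zeta_sub_pow two_pos hζ'
    rw [Nat.totient_prime_pow hp.1 two_pos, ← hlp, show 2 - 1 = 1 from rfl, pow_one, pow_mul] at h1
    exact (pow_left_inj₀ (by positivity) (norm_nonneg _) hp1.ne').1 h1
  have hρl : ‖ζ - 1‖ < ‖ζ' - 1‖ := by
    rw [← hρp]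
    exact pow_lt_self_of_lt_one₀ (norm_pos_iff.2 hρ) hρ1 hp.1.one_lt
  have simρ : Sim (ζ - 1) ((ζ' - 1) ^ p) := by
    have := pow_p_sim hlp hρ1 hρl
    rwa [hζζ] at this
  -- α^p - 1
  have s1 := pow_p_sim hlp hy hly
  obtain ⟨i, hi⟩ := valT one_pos (hprim1 hζ) s1.1 (fun σ hσ => by
    rw [map_sub, map_one, h.2.2 σ hσ])
  have hn := s1.norm_eq
  rw [norm_pow] at hn
  have hi0 : 0 < i := by
    by_contra h0
    push Not at h0
    have := one_le_zpow_of_nonpos₀ (norm_pos_iff.2 hl) hl1.le h0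
    rw [← hi, hn] at this
    exact absurd (pow_lt_one₀ (norm_nonneg _) hy hp.1.ne_zero) (not_lt.2 this)
  have hip : i < p := by
    by_contra h0
    push Not at h0
    have h2 := zpow_le_zpow_right_of_le_one₀ (norm_pos_iff.2 hl) hl1.le h0
    rw [← hi, hn, zpow_natCast] at h2
    exact absurd (pow_lt_pow_left₀ hly (norm_nonneg _) hp.1.ne_zero) (not_lt.2 h2)
  obtain ⟨b, N, hN0, hN, hb, hlt⟩ := normalize hl hi
  lift i to ℕ using hi0.le
  rw [zpow_natCast] at hi hlt
  have hb1 := norm_root hN0.ne' hb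
  have hb0 : b ≠ 0 := by rintro rfl; simp at hb1
  have s2 : Sim ((α - 1) ^ p) (b * (ζ - 1) ^ i) :=
    s1.symm.trans ⟨s1.1, mul_ne_zero hb0 (pow_ne_zero _ hl), hlt⟩
  -- i = 1
  have hi1 : i = 1 := by
    obtain ⟨g, hg, hgo⟩ := exists_primroot p
    obtain ⟨τ, hτ, hτζ⟩ := exists_tau one_pos (hprim1 hζ) hg
    have s3 := sim_tau hζ h hy hly hg hτζ
    have s4 : Sim (τ (ζ - 1)) ((g : Om p) * (ζ - 1)) := by
      rw [map_sub, map_one, hτζ]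
      exact norm_cast_of hl1 hl hg
    have s5 := s2.map τ
    rw [map_mul, map_pow, map_pow, mem_II.1 hτ N b hN hb] at s5
    have s6 := ((s3.pow p).symm.trans s5).trans ((Sim.refl hb0).mul (s4.pow i))
    rw [mul_pow, mul_pow] at s6
    have s7 : Sim ((g : Om p) ^ p * (α - 1) ^ p) ((g : Om p) ^ i * (b * (ζ - 1) ^ i)) := by
      convert s6 using 1; ring
    have s8 := s7.cancel s2
    rw [← Nat.cast_pow, ← Nat.cast_pow] at s8
    have h9 := sim_natCast s8
    push_cast at h9
    rw [ZMod.pow_card] at h9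
    have hg0 : (g : ZMod p) ≠ 0 := by
      intro h0
      rw [h0, orderOf_zero] at hgo
      omega
    obtain ⟨e, rfl⟩ : ∃ e, i = e + 1 := ⟨i - 1, by omega⟩
    have h10 : (g : ZMod p) ^ e = 1 := by
      rw [pow_succ] at h9
      exact (mul_eq_right₀ hg0).1 h9.symm
    have h11 := orderOf_dvd_of_pow_eq_one h10
    rw [hgo] at h11
    have : e = 0 := Nat.eq_zero_of_dvd_of_lt h11 (by omega)
    omega
  subst hi1
  rw [pow_one] at s2
  -- b is congruent to an integer
  obtain ⟨φ, hφζ', hφ⟩ := exists_phi two_pos hζ'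
  have hφζ : φ ζ = ζ := by rw [← hζζ, map_pow, hφζ']
  have s3 := sim_tau hζ h hy hly (τ := φ) (Nat.coprime_one_left p) (by rw [pow_one, hφζ])
  rw [Nat.cast_one, one_mul] at s3
  have s4 := s2.map φ
  rw [map_pow, map_mul, map_sub φ ζ, map_one, hφζ, hφ N hN b hb] at s4
  have s5 := ((s3.pow p).symm.trans s4).symm.trans s2
  obtain ⟨j, hj, sj⟩ := exists_nat_sim hb1 (s5.cancel (Sim.refl hl))
  have sjp : Sim (j : Om p) ((j : Om p) ^ p) := by
    apply Sim.of_lt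
    rw [norm_pow, norm_natCast_eq hj, one_pow]
    have : ((j : Om p) - (j : Om p) ^ p) = ((j - j ^ p : ℤ) : Om p) := by push_cast; ring
    rw [this, norm_intCast_lt, ← ZMod.intCast_zmod_eq_zero_iff_dvd]
    push_cast
    rw [ZMod.pow_card, sub_self]
  have s6 : Sim ((α - 1) ^ p) (((j : Om p) * (ζ' - 1)) ^ p) := by
    rw [mul_pow]
    exact s2.trans ((sj.trans sjp).mul simρ)
  have s7 : Sim (α - 1) ((j : Om p) * (ζ' - 1)) := by
    have hj0 : (j : Om p) ≠ 0 := by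
      rw [← norm_ne_zero_iff, norm_natCast_eq hj]; exact one_ne_zero
    refine ⟨norm_pos_iff.1 hy0, mul_ne_zero hj0 hρ, U1_of_pow ?_⟩
    rw [div_pow]; exact s6.2.2
  have s8 := s7.trans (norm_cast_of hρ1 hρ hj).symm
  have hnorm : ‖ζ' ^ j - 1‖ = ‖ζ' - 1‖ := norm_zeta_pow_sub hζ' hj
  refine ⟨by rw [s8.norm_eq, hnorm], j, ?_⟩
  have h9 := s8.lt
  rw [hnorm, sub_sub_sub_cancel_right] at h9
  have hz1 : ‖ζ' ^ j‖ = 1 := by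
    rw [norm_pow, norm_root (pow_ne_zero 2 hp.1.ne_zero) hζ'.pow_eq_one, one_pow]
  have hz0 : ζ' ^ j ≠ 0 := by rw [← norm_ne_zero_iff, hz1]; exact one_ne_zero
  rw [div_sub_one hz0, norm_div, hz1, div_one]
  exact h9

lemma wild1 {ζ ζ' α : Om p} (hζ' : IsPrimitiveRoot ζ' (p ^ 2)) (hζζ : ζ' ^ p = ζ) (hζ : IsPrimitiveRoot ζ p)
    (h : Wk ζ α) (hy : ‖α - 1‖ < 1) {σ : GG p} (hσ : σ ∈ JJ ζ) (hσ' : σ ζ' = ζ') : σ α = α := by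
  by_cases hly : ‖α - 1‖ ≤ ‖ζ - 1‖
  · exact W0 hζ h hly σ hσ
  push Not at hly
  obtain ⟨-, j, hj⟩ := W1 hζ' hζζ hζ h hy hly
  have hz0 : ζ' ≠ 0 := hζ'.ne_zero (pow_ne_zero 2 hp.1.ne_zero)
  have hW : Wk ζ (ζ' ^ j) := ⟨pow_mem (AbF_root (pow_pos hp.1.pos 2) hζ'.pow_eq_one) j, pow_ne_zero _ hz0,
    fun τ hτ => by rw [← pow_mul, mul_comm, pow_mul, hζζ, map_pow, (mem_JJ.1 hτ).2]⟩
  have hW' := h.div hW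
  have h2 : ‖α / ζ' ^ j - 1‖ ≤ ‖ζ - 1‖ := by
    by_contra hcon
    push Not at hcon
    have h3 := (W1 hζ' hζζ hζ hW' (hj.trans (zeta_sub_lt two_pos hζ')) hcon).1
    rw [h3] at hj
    exact lt_irrefl _ hj
  have h3 := W0 hζ hW' h2 σ hσ
  rw [map_div₀, map_pow, hσ'] at h3
  exact (div_left_inj' (pow_ne_zero _ hz0)).1 h3

lemma wild {Z : Om p} {k : ℕ} (hZ : IsPrimitiveRoot Z (p ^ (k + 3))) {α : Om p} (hα : α ∈ AbF p)
    (h : ∀ σ ∈ JJ (Z ^ p ^ (k + 2)), ∃ ξ : Om p, ξ ^ p = 1 ∧ σ α = ξ * α) : ∀ σ ∈ JJ Z, σ α = α := by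
  by_cases hα0 : α = 0
  · intro σ _; rw [hα0, map_zero]
  have hpos : 0 < p ^ (k + 3) := pow_pos hp.1.pos _
  set ζ := Z ^ p ^ (k + 2) with hζd
  set ζ' := Z ^ p ^ (k + 1) with hζd'
  have hζ : IsPrimitiveRoot ζ p := hZ.pow hpos (by ring)
  have hζ' : IsPrimitiveRoot ζ' (p ^ 2) := hZ.pow hpos (by ring)
  have hζζ : ζ' ^ p = ζ := by rw [hζd, hζd', ← pow_mul]; congr 1
  have hl := lam_ne hζ
  have hW : Wk ζ α := ⟨hα, hα0, fun σ hσ => by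
    obtain ⟨ξ, hξ, h1⟩ := h σ hσ
    rw [map_pow, h1, mul_pow, hξ, one_mul]⟩
  -- normalise the valuation
  obtain ⟨s, hs, hsZ, j, hj⟩ : ∃ s, Wk ζ s ∧ (∀ σ : GG p, σ Z = Z → σ s = s) ∧ ∃ j : ℤ, ‖α / s‖ = ‖ζ - 1‖ ^ j := by
    rcases hp.1.eq_two_or_odd' with h2 | hodd
    · subst h2
      obtain ⟨j, hj⟩ := valT one_pos (hprim1 hζ) (pow_ne_zero 2 hα0) hW.2.2
      rw [norm_pow] at hj
      have key : ∀ (x : Om 2) (i : ℤ), ‖x‖ ^ 2 = ‖ζ - 1‖ ^ (i + i) → ‖x‖ = ‖ζ - 1‖ ^ i := by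
        intro x i hx
        rw [zpow_add₀ (norm_ne_zero_iff.2 hl), ← sq] at hx
        exact (pow_left_inj₀ (norm_nonneg _) (zpow_nonneg (norm_nonneg _) _) two_ne_zero).1 hx
      rcases Int.even_or_odd j with ⟨i, rfl⟩ | ⟨i, rfl⟩
      · refine ⟨1, Wk.of_fixed (one_mem _) one_ne_zero fun σ _ => map_one σ, fun σ _ => map_one σ, i, ?_⟩
        rw [div_one]; exact key _ _ hj
      · set w := Z ^ 2 ^ k with hw
        have hw8 : IsPrimitiveRoot w (2 ^ 3) := hZ.pow hpos (by ring)
        have hw0 : w ≠ 0 := hw8.ne_zero (by norm_num)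
        have hζ1 : ζ = -1 := hζ.eq_neg_one_of_two_right
        have hw4 : w ^ 4 = -1 := by rw [← hζ1, hw, hζd, ← pow_mul]; congr 1; ring
        have hs2 : (w + w⁻¹) ^ 2 = 2 := by
          field_simp
          linear_combination hw4
        have hs0 : w + w⁻¹ ≠ 0 := by
          intro h0
          rw [h0] at hs2
          norm_num at hs2
        have hwA : w ∈ AbF 2 := AbF_root (by norm_num) hw8.pow_eq_one
        refine ⟨w + w⁻¹, ⟨add_mem hwA (inv_mem hwA), hs0, fun σ _ => by rw [hs2]; exact map_ofNat σ 2⟩,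
          fun σ hσ => by rw [map_add, map_inv₀, hw, map_pow, hσ], i, ?_⟩
        apply key
        have hn : ‖w + w⁻¹‖ ^ 2 = ‖ζ - 1‖ := by
          rw [← norm_pow, hs2, hζ1]
          have : (-1 - 1 : Om 2) = -2 := by norm_num
          rw [this, norm_neg]
        rw [norm_div, div_pow, hj, hn, zpow_add₀ (norm_ne_zero_iff.2 hl), zpow_one,
          mul_div_cancel_right₀ _ (norm_ne_zero_iff.2 hl), two_mul]
    · refine ⟨1, Wk.of_fixed (one_mem _) one_ne_zero fun σ _ => map_one σ, fun σ _ => map_one σ, ?_⟩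
      obtain ⟨τ, hτ, hτζ⟩ := exists_tau one_pos (hprim1 hζ) (g := 2) (Nat.coprime_two_left.2 hodd)
      have hτ0 : τ α ≠ 0 := (map_ne_zero τ).2 hα0
      obtain ⟨a, ha⟩ := valT one_pos (hprim1 hζ) (div_ne_zero hτ0 (pow_ne_zero 2 hα0)) (hW.twist hζ hτζ)
      refine ⟨-a, ?_⟩
      have hn0 := norm_ne_zero_iff.2 hα0
      rw [zpow_neg, ← ha, div_one, norm_div, norm_map, norm_pow]
      field_simp
  have hW2 := hW.div hs
  obtain ⟨c, N, hN0, hN, hc, hlt⟩ := normalize hl hj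
  have hc0 : c ≠ 0 := by
    rintro rfl
    rw [zero_pow hN0.ne'] at hc
    exact zero_ne_one hc
  have hd0 : c * (ζ - 1) ^ j ≠ 0 := mul_ne_zero hc0 (zpow_ne_zero _ hl)
  have hζA : ζ ∈ AbF p := AbF_root hp.1.pos hζ.pow_eq_one
  have hd : ∀ σ ∈ JJ ζ, σ (c * (ζ - 1) ^ j) = c * (ζ - 1) ^ j := by
    intro σ hσ
    rw [mem_JJ] at hσ
    rw [map_mul, map_zpow₀, map_sub, map_one, hσ.2, mem_II.1 hσ.1 N c hN hc]
  have hWd : Wk ζ (c * (ζ - 1) ^ j) :=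
    Wk.of_fixed (mul_mem (AbF_root hN0 hc) (zpow_mem (sub_mem hζA (one_mem _)) j)) hd0 hd
  intro σ hσ
  rw [mem_JJ] at hσ
  have hσζ : σ ∈ JJ ζ := mem_JJ.2 ⟨hσ.1, by rw [hζd, map_pow, hσ.2]⟩
  have h5 := wild1 hζ' hζζ hζ (hW2.div hWd) hlt hσζ (by rw [hζd', map_pow, hσ.2])
  rw [map_div₀, map_div₀, hd σ hσζ, hsZ σ hσ.2] at h5
  exact (div_left_inj' hs.2.1).1 ((div_left_inj' hd0).1 h5)

end KW

open Polynomial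
namespace KW
variable {p : ℕ} [hp : Fact p.Prime]

/-- Being an eigenvector of `σ` for an `m`-th root of unity. -/
def Eig (m : ℕ) (σ : GG p) (y : Om p) : Prop := ∃ ξ : Om p, ξ ^ m = 1 ∧ σ y = ξ * y

/-- vectors which look like translates of `x` -/
def Tr (H : Subgroup (GG p)) (m : ℕ) (x y : Om p) : Prop :=
  y ∈ AbF p ∧ (∀ σ ∈ H, (σ ^ m) y = y) ∧ ∀ σ ∈ H, ∀ ρ ∈ H, σ x = ρ x → σ y = ρ y

/-- eigenprojection -/
noncomputable def proj (m : ℕ) (w : Om p) (τ : GG p) (y : Om p) (j : ℕ) : Om p :=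
  (m : Om p)⁻¹ * ∑ i ∈ Finset.range m, (w ^ j) ^ i * ((τ⁻¹) ^ i) y

lemma sum_proj {m : ℕ} (hm : 0 < m) {w : Om p} (hw : IsPrimitiveRoot w m) (τ : GG p) (y : Om p) :
    ∑ j ∈ Finset.range m, proj m w τ y j = y := by
  have hm0 : (m : Om p) ≠ 0 := by exact_mod_cast hm.ne'
  simp only [proj]
  rw [← Finset.mul_sum, Finset.sum_comm]
  have : ∀ i ∈ Finset.range m, ∑ j ∈ Finset.range m, (w ^ j) ^ i * ((τ⁻¹) ^ i) y = if i = 0 then (m : Om p) * y else 0 := by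
    intro i hi
    rw [← Finset.sum_mul]
    split_ifs with h
    · simp [h]
    · have h1 : ∑ j ∈ Finset.range m, (w ^ j) ^ i = ∑ j ∈ Finset.range m, (w ^ i) ^ j :=
        Finset.sum_congr rfl fun j _ => by rw [← pow_mul, ← pow_mul, mul_comm]
      have h2 : w ^ i ≠ 1 := hw.pow_ne_one_of_pos_of_lt h (Finset.mem_range.1 hi)
      rw [h1, geom_sum_eq h2, ← pow_mul, mul_comm i, pow_mul, hw.pow_eq_one, one_pow, sub_self, zero_div, zero_mul]
  rw [Finset.sum_congr rfl this, Finset.sum_ite_eq' , if_pos (Finset.mem_range.2 hm), inv_mul_cancel_left₀ hm0]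

lemma map_proj {m : ℕ} {w : Om p} {σ τ : GG p} (hσ : σ w = w) {y : Om p} (hy : y ∈ AbF p) (j : ℕ) :
    σ (proj m w τ y j) = proj m w τ (σ y) j := by
  simp only [proj]
  rw [map_mul, map_inv₀, map_natCast, map_sum]
  congr 1
  refine Finset.sum_congr rfl fun i _ => ?_
  rw [map_mul, map_pow, map_pow, hσ, hy σ]

lemma proj_smul {m : ℕ} {w : Om p} {τ : GG p} {ξ : Om p} (h : τ ξ = ξ) (y : Om p) (j : ℕ) :
    proj m w τ (ξ * y) j = ξ * proj m w τ y j := by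
  simp only [proj]
  rw [mul_left_comm]
  congr 1
  rw [Finset.mul_sum]
  refine Finset.sum_congr rfl fun i _ => ?_
  have h1 : τ⁻¹ ξ = ξ := (AlgEquiv.symm_apply_eq τ).2 h.symm
  have h2 : ((τ⁻¹) ^ i) ξ = ξ := by
    clear * - h1
    induction i with
    | zero => rfl
    | succ i ih => rw [pow_succ, AlgEquiv.mul_apply, h1, ih]
  rw [map_mul, h2]; ring

lemma self_proj {m : ℕ} (hm : 0 < m) {w : Om p} (hw : w ^ m = 1) {τ : GG p} {y : Om p}
    (hτ : τ w = w) (hy : (τ ^ m) y = y) (j : ℕ) : τ (proj m w τ y j) = w ^ j * proj m w τ y j := by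
  have hw0 : w ≠ 0 := by
    rintro rfl
    rw [zero_pow hm.ne'] at hw
    exact zero_ne_one hw
  have h1 : ∑ i ∈ Finset.range m, (w ^ j) ^ (i + 1) * ((τ⁻¹) ^ (i + 1)) y
      = ∑ i ∈ Finset.range m, (w ^ j) ^ i * ((τ⁻¹) ^ i) y := by
    have h2 := Finset.sum_range_succ (fun i => (w ^ j) ^ i * ((τ⁻¹) ^ i) y) m
    rw [Finset.sum_range_succ'] at h2
    have h3 : ((τ⁻¹) ^ m) y = y := by
      rw [inv_pow]; exact (AlgEquiv.symm_apply_eq _).2 hy.symm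
    have h4 : (w ^ j) ^ m = 1 := by rw [← pow_mul, mul_comm j m, pow_mul, hw, one_pow]
    rw [h4, h3, pow_zero, pow_zero, AlgEquiv.one_apply] at h2
    exact add_right_cancel h2
  simp only [proj]
  rw [← h1, map_mul, map_inv₀, map_natCast, map_sum, mul_left_comm]
  congr 1
  rw [h1, Finset.mul_sum]
  refine Finset.sum_congr rfl fun i _ => ?_
  rw [map_mul, map_pow, map_pow, hτ, pow_succ' τ⁻¹, AlgEquiv.mul_apply, pow_succ' (w ^ j), mul_assoc]
  congr 2
  exact τ.apply_symm_apply _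

lemma Tr.map {H : Subgroup (GG p)} {m : ℕ} {x y : Om p} (h : Tr H m x y) {τ : GG p} (hτ : τ ∈ H) : Tr H m x (τ y) := by
  refine ⟨AbF_map h.1 τ, fun σ hσ => ?_, fun σ hσ ρ hρ hx => ?_⟩
  · rw [h.1 (σ ^ m) τ, h.2.1 σ hσ]
  · rw [h.1 σ τ, h.1 ρ τ, h.2.2 σ hσ ρ hρ hx]

lemma Tr.smul {H : Subgroup (GG p)} {m : ℕ} {x y c : Om p} (h : Tr H m x y) (hc : c ∈ AbF p)
    (hcH : ∀ σ ∈ H, σ c = c) : Tr H m x (c * y) := by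
  refine ⟨mul_mem hc h.1, fun σ hσ => ?_, fun σ hσ ρ hρ hx => ?_⟩
  · rw [map_mul, h.2.1 σ hσ, hcH _ (pow_mem hσ m)]
  · rw [map_mul, map_mul, hcH σ hσ, hcH ρ hρ, h.2.2 σ hσ ρ hρ hx]

lemma Tr.sum {H : Subgroup (GG p)} {m : ℕ} {x : Om p} {s : Finset ℕ} {f : ℕ → Om p} (h : ∀ i ∈ s, Tr H m x (f i)) :
    Tr H m x (∑ i ∈ s, f i) := by
  refine ⟨sum_mem fun i hi => (h i hi).1, fun σ hσ => ?_, fun σ hσ ρ hρ hx => ?_⟩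
  · rw [map_sum]; exact Finset.sum_congr rfl fun i hi => (h i hi).2.1 σ hσ
  · rw [map_sum, map_sum]; exact Finset.sum_congr rfl fun i hi => (h i hi).2.2 σ hσ ρ hρ hx

lemma Tr.proj {H : Subgroup (GG p)} {m : ℕ} (hm : 0 < m) {w : Om p} (hw : w ^ m = 1) (hwH : ∀ σ ∈ H, σ w = w)
    {x y : Om p} (h : Tr H m x y) {τ : GG p} (hτ : τ ∈ H) (j : ℕ) : Tr H m x (proj m w τ y j) := by
  have hwA : w ∈ AbF p := AbF_root hm hw
  refine Tr.smul (Tr.sum fun i _ => Tr.smul (h.map (pow_mem (inv_mem hτ) i)) ?_ ?_) ?_ ?_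
  · exact pow_mem (pow_mem hwA j) i
  · intro σ hσ; rw [map_pow, map_pow, hwH σ hσ]
  · exact inv_mem (natCast_mem _ m)
  · intro σ _; rw [map_inv₀, map_natCast]

lemma eigen_aux {H : Subgroup (GG p)} {m : ℕ} (hm : 0 < m) {w : Om p} (hw : IsPrimitiveRoot w m)
    (hwH : ∀ σ ∈ H, σ w = w) {x : Om p} (L : List (GG p)) (hL : ∀ σ ∈ L, σ ∈ H) {y : Om p} (hy : Tr H m x y) :
    y ∈ AddSubmonoid.closure {z | Tr H m x z ∧ ∀ σ ∈ L, Eig m σ z} := by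
  induction L with
  | nil => exact AddSubmonoid.subset_closure ⟨hy, by simp⟩
  | cons τ L ih =>
    have hτ : τ ∈ H := hL τ (by simp)
    have h1 := ih (fun σ hσ => hL σ (by simp [hσ]))
    refine (AddSubmonoid.closure_le.2 ?_) h1
    rintro z ⟨hz, hE⟩
    change z ∈ AddSubmonoid.closure _
    rw [← sum_proj hm hw τ z]
    refine sum_mem fun j _ => AddSubmonoid.subset_closure ⟨hz.proj hm hw.pow_eq_one hwH hτ j, fun σ hσ => ?_⟩
    rcases List.mem_cons.1 hσ with rfl | hσ'
    · exact ⟨w ^ j, by rw [← pow_mul, mul_comm, pow_mul, hw.pow_eq_one, one_pow],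
        self_proj hm hw.pow_eq_one (hwH σ hτ) (hz.2.1 σ hτ) j⟩
    · obtain ⟨ξ, hξ, h2⟩ := hE σ hσ'
      refine ⟨ξ, hξ, ?_⟩
      have : NeZero m := ⟨hm.ne'⟩
      obtain ⟨i, -, rfl⟩ := hw.eq_pow_of_pow_eq_one hξ
      rw [map_proj (hwH σ (hL σ hσ)) hz.1, h2, proj_smul (by rw [map_pow, hwH τ hτ])]

lemma eigen {H : Subgroup (GG p)} {m : ℕ} (hm : 0 < m) {w : Om p} (hw : IsPrimitiveRoot w m)
    (hwH : ∀ σ ∈ H, σ w = w) {x : Om p} (hx : x ∈ AbF p) (hxm : ∀ σ ∈ H, (σ ^ m) x = x) (K : Set (GG p))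
    (hK : ∀ α ∈ AbF p, (∀ σ ∈ H, ∃ ξ : Om p, ξ ^ m = 1 ∧ σ α = ξ * α) → ∀ σ ∈ K, σ α = α) :
    ∀ σ ∈ K, σ x = x := by
  classical
  have hi : IsIntegral ℚ_[p] x := Algebra.IsIntegral.isIntegral x
  have h1 : ∀ r : Om p, ∃ ρ ∈ H, (∃ σ ∈ H, σ x = r) → ρ x = r := by
    intro r
    by_cases h : ∃ σ ∈ H, σ x = r
    · obtain ⟨σ, hσ, h⟩ := h
      exact ⟨σ, hσ, fun _ => h⟩
    · exact ⟨1, one_mem H, fun h' => absurd h' h⟩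
  choose R hRH hR using h1
  let L := ((minpoly ℚ_[p] x).aroots (Om p)).toFinset.toList.map R
  have hL : ∀ σ ∈ L, σ ∈ H := by
    intro σ hσ
    obtain ⟨r, -, rfl⟩ := List.mem_map.1 hσ
    exact hRH r
  have h2 := eigen_aux hm hw hwH (x := x) L hL (y := x) ⟨hx, hxm, fun σ _ ρ _ h => h⟩
  intro σ hσ
  let S : AddSubmonoid (Om p) :=
    { carrier := {z | σ z = z}
      zero_mem' := map_zero σ
      add_mem' := fun {a b} ha hb => by
        change σ (a + b) = a + b
        rw [map_add, ha, hb] }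
  have h3 : AddSubmonoid.closure {z | Tr H m x z ∧ ∀ σ ∈ L, Eig m σ z} ≤ S := by
    rw [AddSubmonoid.closure_le]
    rintro z ⟨hz, hE⟩
    refine hK z hz.1 (fun τ hτ => ?_) σ hσ
    have h4 : R (τ x) ∈ L := by
      refine List.mem_map.2 ⟨τ x, ?_, rfl⟩
      rw [Finset.mem_toList, Multiset.mem_toFinset, mem_aroots]
      refine ⟨minpoly.ne_zero hi, ?_⟩
      have : aeval (τ x) (minpoly ℚ_[p] x) = τ (aeval x (minpoly ℚ_[p] x)) := by
        rw [aeval_algEquiv]; rfl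
      rw [this, minpoly.aeval, map_zero]
    obtain ⟨ξ, hξ, h5⟩ := hE _ h4
    refine ⟨ξ, hξ, ?_⟩
    rw [← h5]
    exact hz.2.2 τ hτ _ (hRH _) (hR _ ⟨τ, hτ, rfl⟩).symm
  exact h3 h2

end KW

open Polynomial
namespace KW
variable {p : ℕ} [hp : Fact p.Prime]

lemma step_tame {ζ : Om p} (hζ : IsPrimitiveRoot ζ p) {m : ℕ} (hm : m.Coprime p) {x : Om p} (hx : x ∈ AbF p)
    (h : ∀ σ : GG p, (σ ^ m) x = x) : ∀ σ ∈ JJ ζ, σ x = x := by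
  have hm0 := Nat.pos_of_ne_zero (ne_zero_of_coprime hm)
  obtain ⟨w, hw⟩ := exists_prim (p := p) m hm0
  exact eigen hm0 hw (H := II p) (fun σ hσ => mem_II.1 hσ m w hm hw.pow_eq_one) hx (fun σ _ => h σ)
    (JJ ζ : Set (GG p)) (fun α hα hE => tame hζ hα hm hE)

lemma step_prime {Z : Om p} {k : ℕ} (hZ : IsPrimitiveRoot Z (p ^ (k + 3))) {q : ℕ} (hq : q.Prime) {x : Om p}
    (hx : x ∈ AbF p) (h : ∀ σ : GG p, (σ ^ q) x = x) : ∀ σ ∈ JJ Z, σ x = x := by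
  have hpos : 0 < p ^ (k + 3) := pow_pos hp.1.pos _
  have hζ : IsPrimitiveRoot (Z ^ p ^ (k + 2)) p := hZ.pow hpos (by ring)
  by_cases hqp : q = p
  · subst hqp
    exact eigen hp.1.pos hζ (H := JJ (Z ^ q ^ (k + 2))) (fun σ hσ => (mem_JJ.1 hσ).2) hx (fun σ _ => h σ)
      (JJ Z : Set (GG q)) (fun α hα hE => wild hZ hα hE)
  · intro σ hσ
    rw [mem_JJ] at hσ
    refine step_tame hζ ((Nat.coprime_primes hq hp.1).2 hqp) hx h σ (mem_JJ.2 ⟨hσ.1, ?_⟩)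
    rw [map_pow, hσ.2]

lemma map_mem_of_le {M : IntermediateField ℚ_[p] (Om p)} (hM : M ≤ AbF p) (σ : GG p) {x : Om p} (hx : x ∈ M) :
    σ x ∈ M := by
  have := mem_adjoin_of_fixed (M : Set (Om p)) (σ x) fun τ hτ => by
    rw [hM hx τ σ, hτ x hx]
  rwa [IntermediateField.adjoin_self] at this

lemma normal_of_le {M : IntermediateField ℚ_[p] (Om p)} (hM : M ≤ AbF p) : Normal ℚ_[p] M := by
  rw [IntermediateField.normal_iff_forall_map_le']
  rintro σ _ ⟨x, hx, rfl⟩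
  exact map_mem_of_le hM σ hx

lemma le_AbF {F : IntermediateField ℚ_[p] (Om p)} [Normal ℚ_[p] F]
    (hab : ∀ σ τ : F ≃ₐ[ℚ_[p]] F, σ * τ = τ * σ) : F ≤ AbF p := by
  intro x hx σ τ
  have key : ∀ (ρ : GG p) (y : F), ρ (y : Om p) = ((ρ.restrictNormal F y : F) : Om p) := fun ρ y =>
    (AlgEquiv.restrictNormal_commutes ρ F y).symm
  have := congrArg (fun f : F ≃ₐ[ℚ_[p]] F => ((f ⟨x, hx⟩ : F) : Om p)) (hab (σ.restrictNormal F) (τ.restrictNormal F))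
  simp only [AlgEquiv.mul_apply] at this
  rw [← key, ← key, ← key, ← key] at this
  exact this

lemma no_sq {a b r : ℚ_[2]} (h : a ^ 2 + b ^ 2 + r ^ 2 = 0) : r = 0 := by
  have dec : ∀ x y z : ZMod (2 ^ 2), x ^ 2 + y ^ 2 + z ^ 2 = 0 → x ≠ 1 := by decide
  have key : ∀ a b r : ℚ_[2], a ^ 2 + b ^ 2 + r ^ 2 = 0 → ‖b‖ ≤ ‖a‖ → ‖r‖ ≤ ‖a‖ → a = 0 := by
    intro a b r h hb hr
    by_contra ha
    have hpos := norm_pos_iff.2 ha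
    let y : ℤ_[2] := ⟨b / a, by rw [norm_div]; exact div_le_one_of_le₀ hb hpos.le⟩
    let z : ℤ_[2] := ⟨r / a, by rw [norm_div]; exact div_le_one_of_le₀ hr hpos.le⟩
    have h1 : (1 : ℤ_[2]) ^ 2 + y ^ 2 + z ^ 2 = 0 := by
      apply Subtype.ext
      change (1 : ℚ_[2]) ^ 2 + (b / a) ^ 2 + (r / a) ^ 2 = 0
      field_simp
      linear_combination h
    have h2 := congrArg (PadicInt.toZModPow 2) h1
    rw [map_add, map_add, map_pow, map_pow, map_pow, map_one, map_zero] at h2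
    exact dec _ _ _ h2 rfl
  by_contra hr
  rcases le_total ‖a‖ ‖b‖ with h1 | h1
  · rcases le_total ‖b‖ ‖r‖ with h2 | h2
    · exact hr (key r a b (by linear_combination h) (h1.trans h2) h2)
    · have hb := key b a r (by linear_combination h) h1 h2
      rw [hb, norm_zero] at h2
      exact hr (norm_le_zero_iff.1 h2)
  · rcases le_total ‖a‖ ‖r‖ with h2 | h2
    · exact hr (key r a b (by linear_combination h) h2 (h1.trans h2))
    · have hb := key a b r h h1 h2
      rw [hb, norm_zero] at h2
      exact hr (norm_le_zero_iff.1 h2)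

lemma two_aux {I : Om 2} (hI : I ^ 2 = -1) {s : GG 2} (hs : s I = -I) {α : Om 2} (hα : α ∈ AbF 2)
    (hE : ∀ σ : GG 2, σ I = I → σ α = α ∨ σ α = -α) : s (s α) = α := by
  by_contra hcon
  have hs2 : (s * s) I = I := by rw [AlgEquiv.mul_apply, hs, map_neg, hs, neg_neg]
  have hneg : s (s α) = -α := (hE (s * s) hs2).resolve_left hcon
  have hα0 : α ≠ 0 := by rintro rfl; simp at hcon
  have hI0 : I ≠ 0 := by rintro rfl; norm_num at hI
  -- elements fixed by stabilizer of I and s are in the base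
  have base : ∀ x : Om 2, (∀ σ : GG 2, σ I = I → σ x = x) → s x = x → ∃ a : ℚ_[2], algebraMap ℚ_[2] (Om 2) a = x := by
    intro x h1 h2
    refine mem_bot_of_fixed x fun σ => ?_
    have h3 : (σ I - I) * (σ I + I) = 0 := by
      have : (σ I) ^ 2 = -1 := by rw [← map_pow, hI, map_neg, map_one]
      linear_combination this - hI
    rcases mul_eq_zero.1 h3 with h | h
    · exact h1 σ (sub_eq_zero.1 h)
    · have h4 := h1 (s⁻¹ * σ) (by
        rw [AlgEquiv.mul_apply, eq_neg_of_add_eq_zero_left h]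
        exact (AlgEquiv.symm_apply_eq s).2 hs.symm)
      rw [AlgEquiv.mul_apply] at h4
      have h5 := (AlgEquiv.symm_apply_eq s).1 h4
      rw [h5, h2]
  have hsq : ∀ σ : GG 2, σ I = I → (σ α) ^ 2 = α ^ 2 := by
    intro σ hσ
    rcases hE σ hσ with h | h <;> rw [h]
    ring
  have hmul : ∀ σ : GG 2, σ I = I → σ α * s (σ α) = α * s α := by
    intro σ hσ
    rcases hE σ hσ with h | h <;> rw [h]
    rw [map_neg]; ring
  obtain ⟨r, hr⟩ := base (α * s α * I) (fun σ hσ => by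
      rw [map_mul, map_mul, hσ, hα σ s, hmul σ hσ])
    (by rw [map_mul, map_mul, hs, hneg]; ring)
  obtain ⟨a, ha⟩ := base ((α ^ 2 + (s α) ^ 2) / 2) (fun σ hσ => by
      rw [map_div₀, map_add, map_pow, map_pow, hα σ s, ← map_pow s, hsq σ hσ, map_pow, map_ofNat])
    (by rw [map_div₀, map_add, map_pow, map_pow, hneg, map_ofNat]; ring)
  obtain ⟨b, hb⟩ := base ((α ^ 2 - (s α) ^ 2) / (2 * I)) (fun σ hσ => by
      rw [map_div₀, map_sub, map_pow, map_pow, hα σ s, ← map_pow s, hsq σ hσ, map_pow, map_mul, map_ofNat, hσ])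
    (by rw [map_div₀, map_sub, map_pow, map_pow, hneg, map_mul, map_ofNat, hs]; field_simp; ring)
  have hfin : a ^ 2 + b ^ 2 + r ^ 2 = 0 := by
    apply (algebraMap ℚ_[2] (Om 2)).injective
    rw [map_add, map_add, map_pow, map_pow, map_pow, map_zero, ha, hb, hr]
    field_simp
    rw [show (2 : Om 2) ^ 2 = 4 by norm_num]
    have : I ^ 4 = 1 := by linear_combination (I ^ 2 - 1) * hI
    linear_combination (α^4 + (s α)^4 + 2*α^2*(s α)^2) * hI + 4*α^2*(s α)^2 * this
  have hr0 := no_sq hfin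
  rw [hr0, map_zero] at hr
  have hs0 : s α ≠ 0 := (map_ne_zero s).2 hα0
  exact mul_ne_zero (mul_ne_zero hα0 hs0) hI0 hr.symm

end KW

open Polynomial
namespace KW
variable {p : ℕ} [hp : Fact p.Prime]

lemma grp_aux {A : Type*} [CommGroup A] [Finite A] (H : Subgroup A) (hH : H ≠ ⊤) :
    ∃ q : ℕ, q.Prime ∧ ∃ K : Subgroup A, K ≠ ⊤ ∧ H ≤ K ∧ ∀ a : A, a ^ q ∈ K := by
  have hcard : Nat.card (A ⧸ H) ≠ 1 := by
    intro h
    exact hH (Subgroup.index_eq_one.1 h)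
  obtain ⟨q, hq, hdvd⟩ := Nat.exists_prime_and_dvd hcard
  have : Fact q.Prime := ⟨hq⟩
  obtain ⟨y, hy⟩ := exists_prime_orderOf_dvd_card' (G := A ⧸ H) q hdvd
  have hninj : ¬ Function.Injective (powMonoidHom q : A ⧸ H →* A ⧸ H) := by
    intro hinj
    have h1 : y = 1 := hinj (by
      change y ^ q = 1 ^ q
      rw [one_pow, ← hy, pow_orderOf_eq_one])
    rw [h1, orderOf_one] at hy
    exact hq.one_lt.ne hy
  have hnsurj : ¬ Function.Surjective (powMonoidHom q : A ⧸ H →* A ⧸ H) := by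
    rwa [← Finite.injective_iff_surjective]
  refine ⟨q, hq, (powMonoidHom q : A ⧸ H →* A ⧸ H).range.comap (QuotientGroup.mk' H), ?_, ?_, ?_⟩
  · intro h
    apply hnsurj
    intro z
    obtain ⟨a, rfl⟩ := QuotientGroup.mk'_surjective H z
    have : a ∈ (powMonoidHom q : A ⧸ H →* A ⧸ H).range.comap (QuotientGroup.mk' H) := by rw [h]; trivial
    exact this
  · intro a ha
    refine ⟨1, ?_⟩
    rw [map_one]
    exact ((QuotientGroup.eq_one_iff a).2 ha).symm
  · intro a
    exact ⟨QuotientGroup.mk' H a, by simp⟩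

lemma corr {M : IntermediateField ℚ_[p] (Om p)} [FiniteDimensional ℚ_[p] M] [Normal ℚ_[p] M]
    (H : Subgroup (GG p)) (τ : GG p)
    (h : ∀ x ∈ M, (∀ σ ∈ H, σ x = x) → τ x = x) : ∃ g ∈ H, ∀ x ∈ M, τ x = g x := by
  let r : GG p →* (M ≃ₐ[ℚ_[p]] M) := AlgEquiv.restrictNormalHom M
  have key : ∀ (ρ : GG p) (y : M), ((r ρ y : M) : Om p) = ρ (y : Om p) := fun ρ y =>
    (AlgEquiv.restrictNormal_commutes ρ M y)
  have h1 : r τ ∈ IntermediateField.fixingSubgroup (IntermediateField.fixedField (H.map r)) := by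
    rw [IntermediateField.mem_fixingSubgroup_iff]
    intro x hx
    apply Subtype.ext
    rw [key]
    refine h x x.2 fun σ hσ => ?_
    rw [← key]
    exact congrArg _ (hx ⟨r σ, Subgroup.mem_map_of_mem r hσ⟩)
  rw [IntermediateField.fixingSubgroup_fixedField] at h1
  obtain ⟨g, hg, hgr⟩ := h1
  exact ⟨g, hg, fun x hx => by rw [← key τ ⟨x, hx⟩, ← hgr, key]⟩

lemma gen {M : IntermediateField ℚ_[p] (Om p)} [FiniteDimensional ℚ_[p] M] (hM : M ≤ AbF p)
    (H : Subgroup (GG p))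
    (h : ∀ x ∈ M, ∀ q : ℕ, q.Prime → (∀ σ : GG p, (σ ^ q) x = x) → (∀ g ∈ H, g x = x) → ∀ σ : GG p, σ x = x)
    (σ : GG p) : ∃ g ∈ H, ∀ x ∈ M, σ x = g x := by
  have := normal_of_le hM
  let r : GG p →* (M ≃ₐ[ℚ_[p]] M) := AlgEquiv.restrictNormalHom M
  have key : ∀ (ρ : GG p) (y : M), ((r ρ y : M) : Om p) = ρ (y : Om p) := fun ρ y =>
    (AlgEquiv.restrictNormal_commutes ρ M y)
  have hsurj : Function.Surjective r := AlgEquiv.restrictNormalHom_surjective (Om p)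
  letI : CommGroup (M ≃ₐ[ℚ_[p]] M) := { (inferInstance : Group (M ≃ₐ[ℚ_[p]] M)) with
    mul_comm := by
      intro a b
      obtain ⟨a, rfl⟩ := hsurj a
      obtain ⟨b, rfl⟩ := hsurj b
      ext y
      change ((r a (r b y) : M) : Om p) = ((r b (r a y) : M) : Om p)
      rw [key, key, key, key]
      exact hM y.2 a b }
  suffices hT : H.map r = ⊤ by
    have : r σ ∈ H.map r := by rw [hT]; trivial
    obtain ⟨g, hg, hgr⟩ := this
    exact ⟨g, hg, fun x hx => by rw [← key σ ⟨x, hx⟩, ← hgr, key]⟩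
  by_contra hne
  obtain ⟨q, hq, K, hK, hHK, hpow⟩ := grp_aux (H.map r) hne
  apply hK
  rw [← IntermediateField.fixingSubgroup_fixedField K, eq_top_iff]
  intro ρ _
  obtain ⟨ρ, rfl⟩ := hsurj ρ
  rw [IntermediateField.mem_fixingSubgroup_iff]
  intro x hx
  apply Subtype.ext
  rw [key]
  have hx' : ∀ τ : GG p, r τ ∈ K → τ (x : Om p) = x := by
    intro τ hτ
    rw [← key]
    exact congrArg _ (hx ⟨r τ, hτ⟩)
  refine h x x.2 q hq (fun τ => hx' _ ?_) (fun g hg => hx' _ (hHK (Subgroup.mem_map_of_mem r hg))) ρ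
  rw [map_pow]
  exact hpow (r τ)

/-- Every automorphism has finite order on M. -/
lemma fin_order {M : IntermediateField ℚ_[p] (Om p)} [FiniteDimensional ℚ_[p] M] [IsGalois ℚ_[p] M] (σ : GG p) :
    ∀ x ∈ M, (σ ^ (Module.finrank ℚ_[p] M)) x = x := by
  intro x hx
  let r : GG p →* (M ≃ₐ[ℚ_[p]] M) := AlgEquiv.restrictNormalHom M
  have key : ∀ (ρ : GG p) (y : M), ((r ρ y : M) : Om p) = ρ (y : Om p) := fun ρ y =>
    (AlgEquiv.restrictNormal_commutes ρ M y)
  rw [← key _ ⟨x, hx⟩, map_pow, ← IsGalois.card_aut_eq_finrank, pow_card_eq_one']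
  rfl

lemma closure_form {M : IntermediateField ℚ_[p] (Om p)} [FiniteDimensional ℚ_[p] M] (hM : M ≤ AbF p)
    (c u f g : GG p) (hg : g ∈ Subgroup.closure {c, u, f}) :
    ∃ e i j : ℕ, ∀ x ∈ M, g x = (c ^ e * u ^ i * f ^ j) x := by
  have := normal_of_le hM
  have : IsGalois ℚ_[p] M := {}
  let r : GG p →* (M ≃ₐ[ℚ_[p]] M) := AlgEquiv.restrictNormalHom M
  have key : ∀ (ρ : GG p) (y : M), ((r ρ y : M) : Om p) = ρ (y : Om p) := fun ρ y =>
    (AlgEquiv.restrictNormal_commutes ρ M y)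
  have hcomm : ∀ a b, r a * r b = r b * r a := by
    intro a b
    ext y
    change ((r a (r b y) : M) : Om p) = ((r b (r a y) : M) : Om p)
    rw [key, key, key, key]
    exact hM y.2 a b
  suffices h : ∃ e i j : ℕ, r g = r c ^ e * r u ^ i * r f ^ j by
    obtain ⟨e, i, j, h⟩ := h
    refine ⟨e, i, j, fun x hx => ?_⟩
    rw [← key g ⟨x, hx⟩, ← key _ ⟨x, hx⟩, h, map_mul, map_mul, map_pow, map_pow, map_pow]
  have hsurj : Function.Surjective r := AlgEquiv.restrictNormalHom_surjective (Om p)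
  letI : CommGroup (M ≃ₐ[ℚ_[p]] M) := { (inferInstance : Group (M ≃ₐ[ℚ_[p]] M)) with
    mul_comm := by
      intro a b
      obtain ⟨a, rfl⟩ := hsurj a
      obtain ⟨b, rfl⟩ := hsurj b
      exact hcomm a b }
  induction hg using Subgroup.closure_induction with
  | mem x hx =>
    rcases hx with rfl | rfl | rfl
    · exact ⟨1, 0, 0, by simp⟩
    · exact ⟨0, 1, 0, by simp⟩
    · exact ⟨0, 0, 1, by simp⟩
  | one => exact ⟨0, 0, 0, by simp⟩
  | mul x y _ _ hx hy =>
    obtain ⟨e, i, j, h⟩ := hx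
    obtain ⟨e', i', j', h'⟩ := hy
    refine ⟨e + e', i + i', j + j', ?_⟩
    rw [map_mul, h, h', pow_add, pow_add, pow_add]
    ac_rfl
  | inv x _ hx =>
    obtain ⟨e, i, j, h⟩ := hx
    have hd : 0 < Nat.card (M ≃ₐ[ℚ_[p]] M) := Nat.card_pos
    obtain ⟨d, hd'⟩ : ∃ d, Nat.card (M ≃ₐ[ℚ_[p]] M) = d + 1 := ⟨_, (Nat.succ_pred_eq_of_pos hd).symm⟩
    refine ⟨e * d, i * d, j * d, ?_⟩
    have h1 : r x * (r x) ^ d = 1 := by rw [← pow_succ', ← hd', pow_card_eq_one']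
    rw [map_inv, inv_eq_of_mul_eq_one_right h1, h, pow_mul, pow_mul, pow_mul, mul_pow, mul_pow]

end KW

open Polynomial
namespace KW
variable {p : ℕ} [hp : Fact p.Prime]

lemma inv_app (a : GG p) {x y : Om p} (h : a x = y) : a⁻¹ y = x := by
  rw [← h]; exact a.symm_apply_apply x

lemma pow_app {f : GG p} {w : Om p} {g : ℕ} (h : f w = w ^ g) (j : ℕ) : (f ^ j) w = w ^ (g ^ j) := by
  induction j with
  | zero => simp
  | succ j ih => rw [pow_succ, AlgEquiv.mul_apply, h, map_pow, ih, ← pow_mul, pow_succ]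

lemma gens_ok {Z : Om p} {k : ℕ} (hZ : IsPrimitiveRoot Z (p ^ (k + 3))) (c u f : GG p) (hf : f Z = Z)
    (hf2 : ∀ N : ℕ, N.Coprime p → ∀ z : Om p, z ^ N = 1 → f z = z ^ p)
    (G1 : ∀ σ : GG p, ∃ e s : ℕ, σ Z = (c ^ e * u ^ s) Z)
    {M : IntermediateField ℚ_[p] (Om p)} [FiniteDimensional ℚ_[p] M] (hM : M ≤ AbF p) (σ : GG p) :
    ∃ e i j : ℕ, ∀ x ∈ M, σ x = (c ^ e * u ^ i * f ^ j) x := by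
  obtain ⟨g, hg, hgx⟩ := gen hM (Subgroup.closure {c, u, f}) (by
    intro x hx q hq h hfix σ
    obtain ⟨N, hN, hs⟩ := smooth (step_prime hZ hq (hM hx) h)
    obtain ⟨e, s, hes⟩ := G1 σ
    have hc : c ∈ Subgroup.closure {c, u, f} := Subgroup.subset_closure (by simp)
    have hu : u ∈ Subgroup.closure {c, u, f} := Subgroup.subset_closure (by simp)
    have hff : f ∈ Subgroup.closure {c, u, f} := Subgroup.subset_closure (by simp)
    obtain ⟨j, hj⟩ := exists_frob_pow ((c ^ e * u ^ s)⁻¹ * σ) hN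
    have hfj : (f ^ j) Z = Z := by
      have := pow_app (f := f) (w := Z) (g := 1) (by rw [hf, pow_one]) j
      rwa [one_pow, pow_one] at this
    have h1 := hs ((f ^ j)⁻¹ * ((c ^ e * u ^ s)⁻¹ * σ)) (by
      rw [AlgEquiv.mul_apply, AlgEquiv.mul_apply, hes]
      rw [inv_app (c ^ e * u ^ s) rfl]
      exact inv_app _ hfj) (by
      intro w hw
      rw [AlgEquiv.mul_apply, hj w hw]
      exact inv_app _ (pow_app (hf2 N hN w hw) j))
    have h2 : σ x = (c ^ e * u ^ s * f ^ j) x := by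
      conv_rhs => rw [← h1]
      rw [← AlgEquiv.mul_apply]
      congr 1
      group
    rw [h2]
    exact hfix _ (mul_mem (mul_mem (pow_mem hc _) (pow_mem hu _)) (pow_mem hff _))) σ
  obtain ⟨e, i, j, h⟩ := closure_form hM c u f g hg
  exact ⟨e, i, j, fun x hx => (hgx x hx).trans (h x hx)⟩

lemma exists_c {I : Om 2} (hI : I ^ 2 = -1) {s : GG 2} (hs : s I = -I)
    {M : IntermediateField ℚ_[2] (Om 2)} [FiniteDimensional ℚ_[2] M] (hM : M ≤ AbF 2) :
    ∃ c : GG 2, c I = -I ∧ ∀ x ∈ M, c (c x) = x := by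
  have := normal_of_le hM
  let B : Subgroup (GG 2) := MulAction.stabilizer (GG 2) I
  have hB : ∀ σ : GG 2, σ ∈ B ↔ σ I = I := fun σ => MulAction.mem_stabilizer_iff
  obtain ⟨g, hg, hgx⟩ := corr (M := M) (Subgroup.closure {σ : GG 2 | ∃ b ∈ B, σ = b * b}) (s * s) (by
    intro x hx hfix
    refine eigen (H := B) (m := 2) (w := (-1 : Om 2)) two_pos
      (IsPrimitiveRoot.neg_one 0 (by norm_num)) (by intro σ _; rw [map_neg, map_one]) (hM hx)
      (fun σ hσ => ?_) {s * s} ?_ (s * s) rfl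
    · rw [pow_two]
      exact hfix _ (Subgroup.subset_closure ⟨σ, hσ, rfl⟩)
    · rintro α hα hE _ rfl
      refine two_aux hI hs hα fun σ hσ => ?_
      obtain ⟨ξ, hξ, h⟩ := hE σ ((hB σ).2 hσ)
      rcases mul_self_eq_one_iff.1 ((pow_two ξ).symm.trans hξ) with rfl | rfl
      · left; rw [h, one_mul]
      · right; rw [h]; ring)
  have hb : ∃ b ∈ B, ∀ x ∈ M, g x = b (b x) := by
    clear hgx
    induction hg using Subgroup.closure_induction with
    | mem x hx => obtain ⟨b, hb, rfl⟩ := hx; exact ⟨b, hb, fun x _ => rfl⟩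
    | one => exact ⟨1, one_mem _, fun x _ => rfl⟩
    | mul y z _ _ hy hz =>
      obtain ⟨b, hb, h⟩ := hy
      obtain ⟨b', hb', h'⟩ := hz
      refine ⟨b * b', mul_mem hb hb', fun x hx => ?_⟩
      simp only [AlgEquiv.mul_apply]
      rw [h' x hx, h _ (map_mem_of_le hM _ (map_mem_of_le hM _ hx)), hM (map_mem_of_le hM b' hx) b b']
    | inv y _ hy =>
      obtain ⟨b, hb, h⟩ := hy
      refine ⟨b⁻¹, inv_mem hb, fun x hx => inv_app _ ?_⟩
      rw [h _ (map_mem_of_le hM _ (map_mem_of_le hM _ hx))]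
      have h1 : ∀ y, b (b⁻¹ y) = y := fun y => b.apply_symm_apply y
      rw [h1, h1]
  obtain ⟨b, hbB, hb⟩ := hb
  refine ⟨b⁻¹ * s, ?_, fun x hx => ?_⟩
  · rw [AlgEquiv.mul_apply, hs, map_neg, inv_app b ((hB b).1 hbB)]
  · simp only [AlgEquiv.mul_apply]
    rw [hM (map_mem_of_le hM s hx) s b⁻¹]
    have := hgx x hx
    rw [AlgEquiv.mul_apply, hb x hx] at this
    rw [this, inv_app b rfl, inv_app b rfl]

end KW

open Polynomial
namespace KW
variable {p : ℕ} [hp : Fact p.Prime]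

lemma nt_five_order (k i : ℕ) : 5 ^ i ≡ 1 [MOD 2 ^ (k + 2)] ↔ 2 ^ k ∣ i := by
  rw [← ZMod.orderOf_five k, orderOf_dvd_iff_pow_eq_one, ← ZMod.natCast_eq_natCast_iff]
  simp

lemma nt_five (k a : ℕ) (ha : a % 4 = 1) : ∃ s, 5 ^ s ≡ a [MOD 2 ^ (k + 2)] := by
  have h4 : 2 ^ (k + 2) = 4 * 2 ^ k := by ring
  have hpos : 0 < 2 ^ k := by positivity
  have h5 : ∀ s, 5 ^ s % 2 ^ (k + 2) % 4 = 1 := by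
    intro s
    rw [Nat.mod_mod_of_dvd _ (h4 ▸ dvd_mul_right 4 _), Nat.pow_mod]
    simp
  have hlt : ∀ b : ℕ, b % 2 ^ (k + 2) / 4 < 2 ^ k := by
    intro b
    have := Nat.mod_lt b (show 0 < 2 ^ (k + 2) by positivity)
    omega
  have hinj : Set.InjOn (fun s => 5 ^ s % 2 ^ (k + 2) / 4) (Finset.range (2 ^ k) : Set ℕ) := by
    intro s hs t ht hst
    simp only [Finset.coe_range, Set.mem_Iio] at hs ht
    have h1 := h5 s
    have h2 := h5 t
    dsimp only at hst
    have h3 : 5 ^ s % 2 ^ (k + 2) = 5 ^ t % 2 ^ (k + 2) := by omega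
    have h6 : (5 : ZMod (2 ^ (k + 2))) ^ s = 5 ^ t := by
      have := (ZMod.natCast_eq_natCast_iff (5 ^ s) (5 ^ t) (2 ^ (k + 2))).2 h3
      simpa using this
    exact pow_injOn_Iio_orderOf (by rw [ZMod.orderOf_five]; exact hs) (by rw [ZMod.orderOf_five]; exact ht) h6
  have hsurj := Finset.surjOn_of_injOn_of_card_le (s := Finset.range (2 ^ k)) (t := Finset.range (2 ^ k))
    (fun s => 5 ^ s % 2 ^ (k + 2) / 4) (fun s _ => by simpa using hlt _) hinj le_rfl
  obtain ⟨s, -, hs⟩ := hsurj (show a % 2 ^ (k + 2) / 4 ∈ (Finset.range (2 ^ k) : Set ℕ) by simpa using hlt a)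
  refine ⟨s, ?_⟩
  have h1 := h5 s
  have h2 : a % 2 ^ (k + 2) % 4 = 1 := by rw [Nat.mod_mod_of_dvd _ (h4 ▸ dvd_mul_right 4 _), ha]
  dsimp only at hs
  unfold Nat.ModEq
  omega

lemma nt_odd (hp2 : p ≠ 2) (n : ℕ) : ∃ g : ℕ, g.Coprime p ∧
    (∀ a : ℕ, a.Coprime p → ∃ s, g ^ s ≡ a [MOD p ^ (n + 3)]) ∧
    ∀ i, g ^ i ≡ 1 [MOD p ^ (n + 2)] → (p - 1) * p ^ n ∣ i := by
  have hc := ZMod.isCyclic_units_of_prime_pow p hp.1 hp2 (n + 3)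
  have : NeZero (p ^ (n + 3)) := ⟨pow_ne_zero _ hp.1.ne_zero⟩
  have : NeZero (p ^ (n + 2)) := ⟨pow_ne_zero _ hp.1.ne_zero⟩
  obtain ⟨γ, hγ⟩ := hc.exists_generator
  let g := (γ : ZMod (p ^ (n + 3))).val
  have hgγ : ((g : ℕ) : ZMod (p ^ (n + 3))) = γ := ZMod.natCast_zmod_val _
  have hgc : g.Coprime (p ^ (n + 3)) := ZMod.val_coe_unit_coprime γ
  have hgp : g.Coprime p := hgc.coprime_dvd_right (dvd_pow_self _ (by omega))
  have hs : ∀ a : ℕ, a.Coprime p → ∃ s, g ^ s ≡ a [MOD p ^ (n + 3)] := by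
    intro a ha
    have hm := hγ (ZMod.unitOfCoprime a (ha.pow_right _))
    rw [← mem_powers_iff_mem_zpowers] at hm
    obtain ⟨s, hs⟩ := hm
    refine ⟨s, ?_⟩
    rw [← ZMod.natCast_eq_natCast_iff, Nat.cast_pow, hgγ, ← Units.val_pow_eq_pow_val]
    have := congrArg (Units.val) hs
    simpa using this
  refine ⟨g, hgp, hs, fun i hi => ?_⟩
  let γ' : (ZMod (p ^ (n + 2)))ˣ := ZMod.unitOfCoprime g (hgp.pow_right _)
  have hgen : ∀ x, x ∈ Subgroup.zpowers γ' := by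
    intro x
    have hx : ((x : ZMod (p ^ (n + 2))).val).Coprime p :=
      (ZMod.val_coe_unit_coprime x).coprime_dvd_right (dvd_pow_self _ (by omega))
    obtain ⟨s, hs⟩ := hs _ hx
    have h1 := hs.of_dvd (pow_dvd_pow p (show n + 2 ≤ n + 3 by omega))
    rw [← ZMod.natCast_eq_natCast_iff, ZMod.natCast_zmod_val, Nat.cast_pow] at h1
    refine ⟨s, Units.ext ?_⟩
    simpa [γ'] using h1
  have ho := orderOf_eq_card_of_forall_mem_zpowers hgen
  rw [Nat.card_eq_fintype_card, ZMod.card_units_eq_totient, Nat.totient_prime_pow_succ hp.1] at ho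
  have hd : orderOf γ' ∣ i := by
    rw [orderOf_dvd_iff_pow_eq_one]
    apply Units.ext
    rw [← ZMod.natCast_eq_natCast_iff] at hi
    simpa [γ'] using hi
  rw [ho] at hd
  refine dvd_trans ⟨p, by ring⟩ hd

end KW

open Polynomial
namespace KW
variable {p : ℕ} [hp : Fact p.Prime]

lemma prim_pow_modEq {z : Om p} {N a b : ℕ} (hN : 0 < N) (hz : IsPrimitiveRoot z N) (h : z ^ a = z ^ b) :
    a ≡ b [MOD N] := by
  rw [pow_eq_pow_mod a hz.pow_eq_one, pow_eq_pow_mod b hz.pow_eq_one] at h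
  exact hz.pow_inj (Nat.mod_lt _ hN) (Nat.mod_lt _ hN) h

lemma pow_of_modEq {z : Om p} {N a b : ℕ} (hz : z ^ N = 1) (h : a ≡ b [MOD N]) : z ^ a = z ^ b := by
  rw [pow_eq_pow_mod a hz, pow_eq_pow_mod b hz, h]

lemma fix_pow {σ : GG p} {x : Om p} (h : σ x = x) (j : ℕ) : (σ ^ j) x = x := by
  have := pow_app (f := σ) (w := x) (g := 1) (by rw [h, pow_one]) j
  rwa [one_pow, pow_one] at this

lemma fix_v {n m : ℕ} (hm : m.Coprime p) {F : IntermediateField ℚ_[p] (Om p)}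
    [FiniteDimensional ℚ_[p] F] [IsGalois ℚ_[p] F] (hF : F ≤ AbF p)
    (hdeg : Module.finrank ℚ_[p] F = p ^ n * m)
    (hab : ∀ σ τ : F ≃ₐ[ℚ_[p]] F, σ * τ = τ * σ)
    {ζ : Om p} (hζ : IsPrimitiveRoot ζ p) {v : GG p} (hv : v ∈ JJ ζ) {x : Om p} (hx : x ∈ F) :
    (v ^ (p ^ n)) x = x := by
  let r : GG p →* (F ≃ₐ[ℚ_[p]] F) := AlgEquiv.restrictNormalHom F
  have key : ∀ (ρ : GG p) (y : F), ((r ρ y : F) : Om p) = ρ (y : Om p) := fun ρ y =>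
    (AlgEquiv.restrictNormal_commutes ρ F y)
  obtain ⟨g, hg, hgx⟩ := corr (M := F) (Subgroup.closure {τ : GG p | ∃ σ : GG p, τ = σ ^ m}) v (by
    intro y hy h
    exact step_tame hζ hm (hF hy) (fun σ => h _ (Subgroup.subset_closure ⟨σ, rfl⟩)) v hv)
  have h1 : r v = r g := by
    ext y
    rw [key, key]
    exact hgx y y.2
  have h2 : r g ^ (p ^ n) = 1 := by
    clear hgx h1
    induction hg using Subgroup.closure_induction with
    | mem y hy =>
      obtain ⟨σ, rfl⟩ := hy
      rw [map_pow, ← pow_mul, mul_comm, ← hdeg, ← IsGalois.card_aut_eq_finrank, pow_card_eq_one']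
    | one => rw [map_one, one_pow]
    | mul y z _ _ hy hz =>
      rw [map_mul, Commute.mul_pow (hab _ _), hy, hz, one_mul]
    | inv y _ hy => rw [map_inv, inv_pow, hy, inv_one]
  rw [← key _ ⟨x, hx⟩, map_pow, h1, h2]
  rfl

lemma finish {n m : ℕ} (hm : m.Coprime p) {F : IntermediateField ℚ_[p] (Om p)}
    [FiniteDimensional ℚ_[p] F] [IsGalois ℚ_[p] F] (hF : F ≤ AbF p)
    (hdeg : Module.finrank ℚ_[p] F = p ^ n * m)
    (hab : ∀ σ τ : F ≃ₐ[ℚ_[p]] F, σ * τ = τ * σ)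
    {ζ₁ ζ₂ Z : Om p} (hζ₁ : IsPrimitiveRoot ζ₁ (p ^ (n + 2)))
    (hζ₂ : IsPrimitiveRoot ζ₂ (p ^ (p ^ n * m) - 1)) (hZ : IsPrimitiveRoot Z (p ^ (n + 3)))
    {M : IntermediateField ℚ_[p] (Om p)} [FiniteDimensional ℚ_[p] M] (hM : M ≤ AbF p)
    (hFM : F ≤ M) (h1M : ζ₁ ∈ M) (h2M : ζ₂ ∈ M)
    {c u f : GG p} {g : ℕ} (hgp : g.Coprime p) (huI : u ∈ II p) (hu : u Z = Z ^ g) (hf : f Z = Z)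
    (hf2 : ∀ N : ℕ, N.Coprime p → ∀ z : Om p, z ^ N = 1 → f z = z ^ p)
    (G1 : ∀ σ : GG p, ∃ e s : ℕ, σ Z = (c ^ e * u ^ s) Z)
    (G2 : ∀ i, g ^ i ≡ 1 [MOD p ^ (n + 2)] → (p - 1) * p ^ n ∣ i)
    (hc : ∀ e i j : ℕ, (c ^ e * u ^ i * f ^ j) ζ₁ = ζ₁ → ∀ x ∈ M, (c ^ e) x = x) :
    F ≤ IntermediateField.adjoin ℚ_[p] {ζ₁, ζ₂} := by
  intro x hx
  refine mem_adjoin_of_fixed _ _ fun σ hσ => ?_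
  have hσ1 : σ ζ₁ = ζ₁ := hσ _ (by simp)
  have hσ2 : σ ζ₂ = ζ₂ := hσ _ (by simp)
  obtain ⟨e, i, j, h⟩ := gens_ok hZ c u f hf hf2 G1 hM σ
  have hce := hc e i j (by rw [← h _ h1M, hσ1])
  have h' : ∀ y ∈ M, σ y = (u ^ i) ((f ^ j) y) := by
    intro y hy
    rw [h y hy, AlgEquiv.mul_apply, AlgEquiv.mul_apply]
    exact hce _ (map_mem_of_le hM _ (map_mem_of_le hM _ hy))
  have hp0 : 0 < p ^ (n + 3) := pow_pos hp.1.pos _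
  -- action on ζ₁
  have : NeZero (p ^ (n + 3)) := ⟨hp0.ne'⟩
  obtain ⟨t, -, ht⟩ := hZ.eq_pow_of_pow_eq_one (show ζ₁ ^ (p ^ (n + 3)) = 1 by
    rw [show p ^ (n + 3) = p ^ (n + 2) * p by ring, pow_mul, hζ₁.pow_eq_one, one_pow])
  have hu1 : u ζ₁ = ζ₁ ^ g := by rw [← ht, map_pow, hu, ← pow_mul, ← pow_mul, mul_comm]
  have hf1 : f ζ₁ = ζ₁ := by rw [← ht, map_pow, hf]
  have hi : (p - 1) * p ^ n ∣ i := by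
    apply G2
    have h3 := h' ζ₁ h1M
    rw [hσ1, fix_pow hf1, pow_app hu1] at h3
    apply prim_pow_modEq (pow_pos hp.1.pos _) hζ₁
    rw [pow_one, ← h3]
  -- action on ζ₂
  have hm0 : 0 < m := Nat.pos_of_ne_zero (ne_zero_of_coprime hm)
  have hd0 : 0 < p ^ n * m := Nat.mul_pos (pow_pos hp.1.pos _) hm0
  have hNc : (p ^ (p ^ n * m) - 1).Coprime p := by
    have h3 : 1 ≤ p ^ (p ^ n * m) := Nat.one_le_pow _ _ hp.1.pos
    have h4 : (p ^ (p ^ n * m) - 1).Coprime (p ^ (p ^ n * m)) := by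
      have := Nat.coprime_self_add_right (m := p ^ (p ^ n * m) - 1) (n := 1)
      rw [Nat.sub_add_cancel h3] at this
      exact this.2 (Nat.coprime_one_right _)
    exact h4.coprime_dvd_right (dvd_pow_self _ hd0.ne')
  have hj : p ^ n * m ∣ j := by
    have h3 := h' ζ₂ h2M
    rw [hσ2, pow_app (hf2 _ hNc _ hζ₂.pow_eq_one), map_pow,
      fix_pow (mem_II.1 huI _ _ hNc hζ₂.pow_eq_one)] at h3
    have h4 : 1 ≡ p ^ j [MOD p ^ (p ^ n * m) - 1] := prim_pow_modEq (Nat.pos_of_ne_zero (ne_zero_of_coprime hNc)) hζ₂ (by rw [pow_one, ← h3])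
    have h5 : p ^ (p ^ n * m) - 1 ∣ p ^ j - 1 := (Nat.modEq_iff_dvd' (Nat.one_le_pow _ _ hp.1.pos)).1 h4
    have h6 := Nat.pow_sub_one_gcd_pow_sub_one p (p ^ n * m) j
    rw [Nat.gcd_eq_left h5] at h6
    have h7 : p ^ (p ^ n * m) = p ^ (Nat.gcd (p ^ n * m) j) := by
      have h8 : 1 ≤ p ^ (p ^ n * m) := Nat.one_le_pow _ _ hp.1.pos
      have h9 : 1 ≤ p ^ (Nat.gcd (p ^ n * m) j) := Nat.one_le_pow _ _ hp.1.pos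
      omega
    have h8 := Nat.pow_right_injective hp.1.two_le h7
    rw [h8]
    exact Nat.gcd_dvd_right _ _
  -- conclusion
  have hfj : (f ^ j) x = x := by
    obtain ⟨l, rfl⟩ := hj
    rw [pow_mul]
    refine fix_pow ?_ l
    rw [← hdeg]
    exact fin_order f x hx
  have hui : (u ^ i) x = x := by
    obtain ⟨l, rfl⟩ := hi
    rw [pow_mul, pow_mul]
    refine fix_pow ?_ l
    have hζ : IsPrimitiveRoot (Z ^ p ^ (n + 2)) p := hZ.pow hp0 (by ring)
    refine fix_v hm hF hdeg hab hζ (mem_JJ.2 ⟨pow_mem huI _, ?_⟩) hx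
    have h3 : u (Z ^ p ^ (n + 2)) = (Z ^ p ^ (n + 2)) ^ g := by
      rw [map_pow, hu, ← pow_mul, ← pow_mul, mul_comm]
    rw [pow_app h3]
    conv_rhs => rw [← pow_one (Z ^ p ^ (n + 2))]
    apply pow_of_modEq hζ.pow_eq_one
    have := Nat.ModEq.pow_totient hgp
    rwa [Nat.totient_prime hp.1] at this
  rw [h' x (hFM hx), hfj, hui]

end KW

open KW
theorem stmt19 (p : ℕ) [Fact p.Prime] (n m : ℕ) (hm : Nat.gcd p m = 1)
    (F : IntermediateField ℚ_[p] (AlgebraicClosure ℚ_[p]))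
    [FiniteDimensional ℚ_[p] ↥F] [IsGalois ℚ_[p] ↥F]
    (hdeg : Module.finrank ℚ_[p] ↥F = p ^ n * m)
    (hab : ∀ σ τ : ↥F ≃ₐ[ℚ_[p]] ↥F, σ * τ = τ * σ)
    (ζ₁ ζ₂ : AlgebraicClosure ℚ_[p])
    (hζ₁ : IsPrimitiveRoot ζ₁ (p ^ (n + 2)))
    (hζ₂ : IsPrimitiveRoot ζ₂ (p ^ (p ^ n * m) - 1)) :
    F ≤ IntermediateField.adjoin ℚ_[p] {ζ₁, ζ₂} := by
  have hp : p.Prime := Fact.out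
  have hm' : m.Coprime p := (Nat.coprime_comm).1 hm
  have hm0 : 0 < m := Nat.pos_of_ne_zero (ne_zero_of_coprime hm')
  have hF : F ≤ AbF p := le_AbF hab
  have hp0 : 0 < p ^ (n + 3) := pow_pos hp.pos _
  have hN : 0 < p ^ (p ^ n * m) - 1 := by
    have := Nat.one_lt_pow (Nat.mul_pos (pow_pos hp.pos n) hm0).ne' hp.one_lt
    omega
  obtain ⟨Z, hZ⟩ := exists_prim (p := p) (p ^ (n + 3)) hp0
  obtain ⟨f, hf, hf2⟩ := exists_phi (by omega) hZ
  let M : IntermediateField ℚ_[p] (Om p) := F ⊔ IntermediateField.adjoin ℚ_[p] {ζ₁, ζ₂}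
  have : FiniteDimensional ℚ_[p] (IntermediateField.adjoin ℚ_[p] ({ζ₁, ζ₂} : Set (Om p))) :=
    IntermediateField.finiteDimensional_adjoin fun x _ => Algebra.IsIntegral.isIntegral x
  have : FiniteDimensional ℚ_[p] M := IntermediateField.finiteDimensional_sup _ _
  have hM : M ≤ AbF p := by
    refine sup_le hF (IntermediateField.adjoin_le_iff.2 ?_)
    rintro y (rfl | rfl)
    · exact AbF_root (pow_pos hp.pos _) hζ₁.pow_eq_one
    · exact AbF_root hN hζ₂.pow_eq_one
  have hFM : F ≤ M := le_sup_left
  have hadj : IntermediateField.adjoin ℚ_[p] {ζ₁, ζ₂} ≤ M := le_sup_right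
  have h1M : ζ₁ ∈ M := hadj (IntermediateField.subset_adjoin _ _ (by simp))
  have h2M : ζ₂ ∈ M := hadj (IntermediateField.subset_adjoin _ _ (by simp))
  by_cases hp2 : p = 2
  · subst hp2
    obtain ⟨u, huI, hu⟩ := exists_tau (g := 5) (by omega) hZ (by norm_num)
    have hI4 : IsPrimitiveRoot (Z ^ 2 ^ (n + 1)) 4 := hZ.pow hp0 (by ring)
    set I := Z ^ 2 ^ (n + 1) with hIdef
    have hsqI : I ^ 2 = -1 := by
      have h1 : (I ^ 2 - 1) * (I ^ 2 + 1) = 0 := by linear_combination hI4.pow_eq_one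
      rcases mul_eq_zero.1 h1 with h | h
      · exact absurd (sub_eq_zero.1 h) (hI4.pow_ne_one_of_pos_of_lt (by norm_num) (by norm_num))
      · exact eq_neg_of_add_eq_zero_left h
    obtain ⟨s, -, hs⟩ := exists_tau (p := 2) (Z := I) (k := 2) (g := 3) (by omega) hI4 (by norm_num)
    have hs' : s I = -I := by rw [hs, pow_succ, hsqI]; ring
    obtain ⟨c, hcI, hc⟩ := exists_c hsqI hs' hM
    have hI0 : I ≠ 0 := hI4.ne_zero (by norm_num)
    have huI' : u I = I := by
      rw [hIdef, map_pow, hu, ← pow_mul, mul_comm, pow_mul, ← hIdef, pow_succ, hI4.pow_eq_one, one_mul]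
    have hfI : f I = I := by rw [hIdef, map_pow, hf]
    -- I is a power of ζ₁
    have hIζ : ∃ t, I = ζ₁ ^ t := by
      have : NeZero (2 ^ (n + 2)) := ⟨by positivity⟩
      obtain ⟨t, -, ht⟩ := hζ₁.eq_pow_of_pow_eq_one (show I ^ (2 ^ (n + 2)) = 1 by
        rw [show 2 ^ (n + 2) = 4 * 2 ^ n by ring, pow_mul, hI4.pow_eq_one, one_pow])
      exact ⟨t, ht.symm⟩
    have G0 : ∀ σ : GG 2, σ I = I → ∃ t : ℕ, σ Z = (u ^ t) Z := by
      intro σ hσ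
      obtain ⟨a, -, haZ⟩ := exists_map_root σ hp0 hZ
      have ha : a % 4 = 1 := by
        have h1 : I ^ a = I ^ 1 := by
          rw [pow_one]
          conv_rhs => rw [← hσ]
          rw [hIdef, map_pow, haZ, ← pow_mul, ← pow_mul, mul_comm]
        exact prim_pow_modEq (by norm_num) hI4 h1
      obtain ⟨t, ht⟩ := nt_five (n + 1) a ha
      refine ⟨t, ?_⟩
      rw [haZ, pow_app hu]
      exact (pow_of_modEq hZ.pow_eq_one ht).symm
    refine finish hm' hF hdeg hab hζ₁ hζ₂ hZ hM hFM h1M h2M (c := c) (g := 5) (by norm_num) huI hu hf hf2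
      (fun σ => ?_) (fun i hi => ?_) (fun e i j h x hx => ?_)
    · have h3 : (σ I - I) * (σ I + I) = 0 := by
        have : (σ I) ^ 2 = -1 := by rw [← map_pow, hsqI, map_neg, map_one]
        linear_combination this - hsqI
      rcases mul_eq_zero.1 h3 with h | h
      · obtain ⟨t, ht⟩ := G0 σ (sub_eq_zero.1 h)
        exact ⟨0, t, by rw [pow_zero, one_mul, ht]⟩
      · obtain ⟨t, ht⟩ := G0 (c⁻¹ * σ) (by
          rw [AlgEquiv.mul_apply, eq_neg_of_add_eq_zero_left h]
          exact inv_app c hcI)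
        refine ⟨1, t, ?_⟩
        rw [pow_one, AlgEquiv.mul_apply, ← ht, ← AlgEquiv.mul_apply, mul_inv_cancel_left]
    · have := (nt_five_order n i).1 hi
      simpa using this
    · obtain ⟨t, ht⟩ := hIζ
      have h4 : (c ^ e * u ^ i * f ^ j) I = I := by rw [ht, map_pow, h]
      rw [AlgEquiv.mul_apply, AlgEquiv.mul_apply, fix_pow hfI, fix_pow huI'] at h4
      have hcc : ∀ l : ℕ, ∀ y ∈ M, (c ^ (2 * l)) y = y := by
        intro l y hy
        rw [pow_mul, pow_two]
        exact fix_pow (hc y hy) l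
      rcases Nat.even_or_odd' e with ⟨l, rfl | rfl⟩
      · exact hcc l x hx
      · exfalso
        have h5 : (c ^ (2 * l)) I = I := hcc l I (by rw [ht]; exact pow_mem h1M t)
        rw [pow_succ, AlgEquiv.mul_apply, hcI, map_neg, h5] at h4
        have h6 : (2 : Om 2) * I = 0 := by linear_combination -h4
        rcases mul_eq_zero.1 h6 with h7 | h7
        · norm_num at h7
        · exact hI0 h7
  · obtain ⟨g, hgp, hg1, hg2⟩ := nt_odd hp2 n
    obtain ⟨u, huI, hu⟩ := exists_tau (g := g) (by omega) hZ hgp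
    refine finish hm' hF hdeg hab hζ₁ hζ₂ hZ hM hFM h1M h2M (c := 1) hgp huI hu hf hf2
      (fun σ => ?_) hg2 (fun e i j h x hx => by rw [one_pow]; rfl)
    obtain ⟨a, ha, haZ⟩ := exists_map_root σ hp0 hZ
    obtain ⟨t, ht⟩ := hg1 a (ha.coprime_dvd_right (dvd_pow_self _ (by omega)))
    refine ⟨0, t, ?_⟩
    rw [pow_zero, one_mul, haZ, pow_app hu]
    exact (pow_of_modEq hZ.pow_eq_one ht).symm
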